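/- Let G be a group containing K₁ × ⋯ × Kₙ as a finite index normal subgroup, where each Kᵢ is identified with a subgroup of G, such that for every g ∈ G and each i there is some j with gKᵢg⁻¹ = Kⱼ. Suppose that for each i, every group containing an isomorphic copy of Kᵢ as a finite index subgroup admits a finite generating set and a normal form with respect to which the solution language of every finite system of equations is EDT0L. Then G admits a finite generating set and a normal form with respect to which the solution language of every finite system of equations in G is EDT0L. -/

import Mathlib

namespace Paper

/-- Apply a letterwise substitution (i.e. the endomorphism of the free monoid `C*`
determined by its action on letters) to a word over `C`. -/
def subApply {C : Type*} (f : C → List C) (w : List C) : List C := (w.map f).flatten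

/-- An EDT0L system: a finite extended alphabet `C`, an identification of some letters of
`C` with terminal letters of the alphabet `α` (injectively, modelling `Σ ⊆ C`), a start
word over `C`, and a rational control: a regular language over a finite set of letterwise
substitutions (endomorphisms of `C*`), a word of endomorphisms acting by composition. -/
structure EDT0LSystem (α : Type*) where
  C : Type
  finC : Fintype C
  term : C → Option α
  term_inj : ∀ c c' a, term c = some a → term c' = some a → c = c'
  start : List C
  ι : Type
  finι : Fintype ι
  tab : ι → C → List C
  control : Language ι
  control_reg : control.IsRegular

/-- The endomorphism of `C*` given by a word of basic endomorphisms, applied to `w`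
(the word `φ₁φ₂⋯φₖ` acts as `φ₁∘φ₂∘⋯∘φₖ`, functions written on the right). -/
def EDT0LSystem.apply {α : Type*} (S : EDT0LSystem α) (φs : List S.ι) (w : List S.C) :
    List S.C :=
  φs.foldl (fun v i => subApply (S.tab i) v) w

/-- The language accepted by an EDT0L system: `{ωφ : φ ∈ R} ∩ Σ*`. -/
def EDT0LSystem.accepts {α : Type*} (S : EDT0LSystem α) : Language α :=
  { w | ∃ φs ∈ S.control, (S.apply φs S.start).map S.term = w.map Option.some }

/-- A language is EDT0L if it is accepted by some EDT0L system. -/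
def IsEDT0L {α : Type*} (L : Language α) : Prop := ∃ S : EDT0LSystem α, S.accepts = L

/-- Evaluate a word over the alphabet `Σ ∪ Σ⁻¹` (a letter is a generator index together
with a sign) in a group. -/
def evalWord {G : Type*} [Group G] {ι : Type*} (gen : ι → G) (w : List (ι × Bool)) : G :=
  (w.map fun l => if l.2 then gen l.1 else (gen l.1)⁻¹).prod

/-- The word length of `g` with respect to the generating set `gen`. -/
noncomputable def wordLength {G : Type*} [Group G] {ι : Type*} (gen : ι → G) (g : G) : ℕ :=
  sInf {n | ∃ w : List (ι × Bool), evalWord gen w = g ∧ w.length = n}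

/-- A normal form is quasigeodesic if `|η(g)| ≤ λ·|g| + λ` for some `λ > 0`. -/
def IsQuasigeodesicNF {G : Type*} [Group G] {ι : Type*} (gen : ι → G)
    (η : G → List (ι × Bool)) : Prop :=
  ∃ lam : ℝ, 0 < lam ∧ ∀ g : G, ((η g).length : ℝ) ≤ lam * (wordLength gen g) + lam

/-- A normal form is regular if its image is a regular language. -/
def IsRegularNF {G : Type*} [Group G] {ι : Type*} (η : G → List (ι × Bool)) : Prop :=
  Language.IsRegular (Set.range η : Language (ι × Bool))

/-- A subset of a group is rational if it is the image of a regular language under the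
evaluation map from the free monoid on a finite monoid generating set. -/
def IsRationalSubset {G : Type*} [Group G] (A : Set G) : Prop :=
  ∃ (ι : Type) (_ : Fintype ι) (gen : ι → G) (L : Language ι),
    Submonoid.closure (Set.range gen) = ⊤ ∧ L.IsRegular ∧
      A = (fun w : List ι => (w.map gen).prod) '' L

/-- A subset of a group is recognisable if its full preimage under the evaluation map
from the free monoid on a finite monoid generating set is a regular language. -/
def IsRecognisableSubset {G : Type*} [Group G] (A : Set G) : Prop :=
  ∃ (ι : Type) (_ : Fintype ι) (gen : ι → G),
    Submonoid.closure (Set.range gen) = ⊤ ∧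
      Language.IsRegular ({w : List ι | (w.map gen).prod ∈ A} : Language ι)

/-- The word `w₁ # w₂ # ⋯ # wₘ` over `β ⊕ {#}`. -/
def hashWord {β : Type*} {m : ℕ} (ws : Fin m → List β) : List (β ⊕ Unit) :=
  List.intercalate [Sum.inr ()] (List.ofFn fun i => (ws i).map Sum.inl)

/-- `g : Fin m → G` is a solution of the system `E ⊆ G ∗ F_X` of equations. -/
def SolvesSystem {G : Type*} [Group G] {m : ℕ}
    (E : Set (Monoid.Coprod G (FreeGroup (Fin m)))) (g : Fin m → G) : Prop :=
  ∀ e ∈ E, Monoid.Coprod.lift (MonoidHom.id G) (FreeGroup.lift g) e = 1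

/-- The solution language of a system of equations with constraints, w.r.t. a normal form. -/
def solutionLanguageC {G : Type*} [Group G] {ι : Type*} (η : G → List (ι × Bool)) {m : ℕ}
    (E : Set (Monoid.Coprod G (FreeGroup (Fin m)))) (Rc : Fin m → Set G) :
    Language ((ι × Bool) ⊕ Unit) :=
  { w | ∃ g : Fin m → G, SolvesSystem E g ∧ (∀ i, g i ∈ Rc i) ∧
      w = hashWord fun i => η (g i) }

/-- The solution language of a system of equations, w.r.t. a normal form. -/
def solutionLanguage {G : Type*} [Group G] {ι : Type*} (η : G → List (ι × Bool)) {m : ℕ}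
    (E : Set (Monoid.Coprod G (FreeGroup (Fin m)))) : Language ((ι × Bool) ⊕ Unit) :=
  solutionLanguageC η E fun _ => Set.univ

/-- Evaluate a twisted word (a word over `H ∪ (F_X × Ω)`) at the assignment `g` of the
variables: each letter `(u, ψ)` becomes `ψ(uφ)` where `φ` is the homomorphism `F_X → H`
determined by `g`, and the word is multiplied out in `H`. -/
def twistedEval {H : Type*} [Group H] {m : ℕ} (Ω : Subgroup (MulAut H)) (g : Fin m → H)
    (w : List (H ⊕ (FreeGroup (Fin m) × Ω))) : H :=
  (w.map (Sum.elim id fun p => (p.2 : MulAut H) (FreeGroup.lift g p.1))).prod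

/-- The solution language of a system of `Ω`-twisted equations with constraints. -/
def twistedSolutionLanguage {H : Type*} [Group H] {ι : Type*} (Ω : Subgroup (MulAut H))
    (η : H → List (ι × Bool)) {m : ℕ}
    (E : Set (List (H ⊕ (FreeGroup (Fin m) × Ω)))) (Rc : Fin m → Set H) :
    Language ((ι × Bool) ⊕ Unit) :=
  { w | ∃ g : Fin m → H, (∀ e ∈ E, twistedEval Ω g e = 1) ∧ (∀ i, g i ∈ Rc i) ∧
      w = hashWord fun i => η (g i) }



/-- A streaming string transducer with copying: a finite nondeterministic automaton with
finitely many registers holding words over `β`, where each transition rewrites every register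
as a concatenation of old registers. In a final state it outputs a word for every index
`j : J`, again a concatenation of registers. -/
structure RegisterMachine (J β : Type) where
  σ : Type
  finσ : Finite σ
  ι : Type
  finι : Finite ι
  C : Type
  finC : Finite C
  initial : Set σ
  ini : σ → C → List β
  src : ι → σ
  tgt : ι → σ
  upd : ι → C → List C
  fin : Set σ
  out : σ → J → List C

namespace RegisterMachine

variable {J β : Type}

/-- The configurations (state and register contents) reachable by a register machine. -/
inductive Reach (M : RegisterMachine J β) : M.σ → (M.C → List β) → Prop
  | initial (s : M.σ) (hs : s ∈ M.initial) : Reach M s (M.ini s)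
  | step (i : M.ι) (ρ : M.C → List β) (h : Reach M (M.src i) ρ) :
      Reach M (M.tgt i) fun c => (M.upd i c).flatMap ρ

/-- The configurations reachable in exactly `n` steps, where idling counts as a step. -/
inductive ReachIn (M : RegisterMachine J β) : ℕ → M.σ → (M.C → List β) → Prop
  | initial (s : M.σ) (hs : s ∈ M.initial) : ReachIn M 0 s (M.ini s)
  | step (n : ℕ) (i : M.ι) (ρ : M.C → List β) (h : ReachIn M n (M.src i) ρ) :
      ReachIn M (n + 1) (M.tgt i) fun c => (M.upd i c).flatMap ρ
  | idle (n : ℕ) (s : M.σ) (ρ : M.C → List β) (h : ReachIn M n s ρ) : ReachIn M (n + 1) s ρ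

theorem Reach.exists_reachIn {M : RegisterMachine J β} {s : M.σ} {ρ : M.C → List β}
    (h : M.Reach s ρ) : ∃ n, M.ReachIn n s ρ := by
  induction h with
  | initial s hs => exact ⟨0, .initial s hs⟩
  | step i ρ _ ih =>
    obtain ⟨n, hn⟩ := ih
    exact ⟨n + 1, .step n i ρ hn⟩

theorem ReachIn.mono {M : RegisterMachine J β} {s : M.σ} {ρ : M.C → List β} {n m : ℕ}
    (h : M.ReachIn n s ρ) (hnm : n ≤ m) : M.ReachIn m s ρ := by
  induction hnm with
  | refl => exact h
  | step _ ih => exact .idle _ _ _ ih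

/-- The set of tuples of words produced by a register machine. -/
def tuples (M : RegisterMachine J β) : Set (J → List β) :=
  { w | ∃ s ρ, M.Reach s ρ ∧ s ∈ M.fin ∧ w = fun j => (M.out s j).flatMap ρ }

end RegisterMachine

/-- A set of tuples of words is EDT0L if it is produced by a register machine. -/
def IsTupleEDT0L {J β : Type} (A : Set (J → List β)) : Prop :=
  ∃ M : RegisterMachine J β, M.tuples = A

theorem subApply_append {C : Type*} (f : C → List C) (u v : List C) :
    subApply f (u ++ v) = subApply f u ++ subApply f v := by
  simp [subApply]

theorem EDT0LSystem.apply_cons {α : Type*} (S : EDT0LSystem α) (i : S.ι) (φs : List S.ι)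
    (w : List S.C) : S.apply (i :: φs) w = S.apply φs (subApply (S.tab i) w) := rfl

theorem EDT0LSystem.apply_append {α : Type*} (S : EDT0LSystem α) (φs : List S.ι)
    (u v : List S.C) : S.apply φs (u ++ v) = S.apply φs u ++ S.apply φs v := by
  induction φs generalizing u v with
  | nil => rfl
  | cons i φs ih => simp only [apply_cons, subApply_append, ih]

theorem EDT0LSystem.apply_eq_flatMap {α : Type*} (S : EDT0LSystem α) (φs : List S.ι)
    (w : List S.C) : S.apply φs w = w.flatMap fun c => S.apply φs [c] := by
  induction w with
  | nil =>
    induction φs with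
    | nil => rfl
    | cons i φs ih => rw [apply_cons]; exact ih
  | cons c w ih => rw [← List.singleton_append, apply_append, ih]; simp

/-- The words derived by an EDT0L system, including those with nonterminal letters, where the
latter are recorded as `none`. -/
theorem EDT0LSystem.isTupleEDT0L_derived {α : Type} (S : EDT0LSystem α) :
    IsTupleEDT0L { w : Unit → List (Option α) |
      ∃ φs ∈ S.control, w = fun _ => (S.apply φs S.start).map S.term } := by
  obtain ⟨σ, _, D, hD⟩ := S.control_reg.reverse
  have := S.finC
  have := S.finι
  let M : RegisterMachine Unit (Option α) :=
    { σ := σ, finσ := inferInstance, ι := σ × S.ι, finι := inferInstance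
      C := S.C, finC := inferInstance
      initial := {D.start}, ini := fun _ c => [S.term c]
      src := Prod.fst, tgt := fun p => D.step p.1 p.2, upd := fun p => S.tab p.2
      fin := D.accept, out := fun _ _ => S.start }
  have hfwd : ∀ s ρ, M.Reach s ρ → ∃ φs : List S.ι, s = D.eval φs.reverse ∧
      ρ = fun c => (S.apply φs [c]).map S.term := by
    intro s ρ h
    induction h with
    | initial s hs => exact ⟨[], hs, rfl⟩
    | step i ρ _ ih =>
      obtain ⟨φs, h1, h2⟩ := ih
      refine ⟨i.2 :: φs, ?_, ?_⟩
      · rw [List.reverse_cons, DFA.eval_append_singleton, ← h1]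
      · funext c
        rw [S.apply_cons, S.apply_eq_flatMap, List.map_flatMap, h2]
        simp [subApply, M]
  have hbwd : ∀ φs : List S.ι,
      M.Reach (D.eval φs.reverse) fun c => (S.apply φs [c]).map S.term := by
    intro φs
    induction φs with
    | nil => exact .initial (M := M) D.start rfl
    | cons i φs ih =>
      have := RegisterMachine.Reach.step (M := M) (D.eval φs.reverse, i) _ ih
      rw [List.reverse_cons, DFA.eval_append_singleton]
      convert this using 1
      funext c
      rw [S.apply_cons, S.apply_eq_flatMap, List.map_flatMap]
      simp [subApply, M]
  have hacc : ∀ φs : List S.ι, φs ∈ S.control ↔ D.eval φs.reverse ∈ D.accept := by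
    intro φs
    rw [← DFA.mem_accepts, hD, Language.reverse_mem_reverse]
  refine ⟨M, Set.ext fun w => ⟨?_, ?_⟩⟩
  · rintro ⟨s, ρ, h, hs, rfl⟩
    obtain ⟨φs, rfl, rfl⟩ := hfwd s ρ h
    refine ⟨φs, (hacc φs).2 hs, ?_⟩
    funext _
    rw [S.apply_eq_flatMap φs S.start, List.map_flatMap]
  · rintro ⟨φs, hφ, rfl⟩
    refine ⟨_, _, hbwd φs, (hacc φs).1 hφ, ?_⟩
    funext _
    rw [S.apply_eq_flatMap φs S.start, List.map_flatMap]

/-- The output of a sequential transducer reading a word from state `q`. -/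
def seqOutput {Q α β : Type} (step : Q → α → Q) (emit : Q → α → List β) : Q → List α → List β
  | _, [] => []
  | q, a :: w => emit q a ++ seqOutput step emit (step q a) w

theorem seqOutput_append {Q α β : Type} (step : Q → α → Q) (emit : Q → α → List β) (q : Q)
    (u v : List α) : seqOutput step emit q (u ++ v) =
      seqOutput step emit q u ++ seqOutput step emit (u.foldl step q) v := by
  induction u generalizing q with
  | nil => rfl
  | cons a u ih => simp [seqOutput, ih]

theorem foldl_flatMap_eq {Q C α : Type} (step : Q → α → Q) (ρ : C → List α) (l : List C) (q : Q) :
    (l.flatMap ρ).foldl step q = l.foldl (fun q c => (ρ c).foldl step q) q := by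
  induction l generalizing q with
  | nil => rfl
  | cons c l ih => simp [ih]

/-- EDT0L sets of tuples are closed under applying sequential transducers to their components,
retaining only those tuples whose runs all end in an accepting state. -/
theorem IsTupleEDT0L.seqOutput {J K Q α β : Type} [Finite K] [Finite Q] {A : Set (J → List α)}
    (hA : IsTupleEDT0L A) (step : Q → α → Q) (emit : K → Q → α → List β) (sel : K → J)
    (q₀ : K → Q) (F : Set Q) :
    IsTupleEDT0L { w : K → List β | ∃ a ∈ A, (∀ k, (a (sel k)).foldl step (q₀ k) ∈ F) ∧
      w = fun k => Paper.seqOutput step (emit k) (q₀ k) (a (sel k)) } := by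
  obtain ⟨M, rfl⟩ := hA
  have := M.finσ
  have := M.finι
  have := M.finC
  let path : (M.C → Q → Q) → K → Q → List M.C → List (M.C × K × Q) := fun τ k q l =>
    Paper.seqOutput (fun q c => τ c q) (fun q c => [(c, k, q)]) q l
  let M' : RegisterMachine K β :=
    { σ := M.σ × (M.C → Q → Q), finσ := inferInstance
      ι := M.ι × (M.C → Q → Q), finι := inferInstance
      C := M.C × K × Q, finC := inferInstance
      initial := {p | p.1 ∈ M.initial ∧ p.2 = fun c q => (M.ini p.1 c).foldl step q}
      ini := fun p x => Paper.seqOutput step (emit x.2.1) x.2.2 (M.ini p.1 x.1)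
      src := fun p => (M.src p.1, p.2)
      tgt := fun p => (M.tgt p.1, fun c q => (M.upd p.1 c).foldl (fun q c => p.2 c q) q)
      upd := fun p x => path p.2 x.2.1 x.2.2 (M.upd p.1 x.1)
      fin := {p | p.1 ∈ M.fin ∧
        ∀ k, (M.out p.1 (sel k)).foldl (fun q c => p.2 c q) (q₀ k) ∈ F}
      out := fun p k => path p.2 k (q₀ k) (M.out p.1 (sel k)) }
  have hpath : ∀ (ρ : M.C → List α) (k : K) (l : List M.C) (q : Q),
      (path (fun c q => (ρ c).foldl step q) k q l).flatMap
        (fun x => Paper.seqOutput step (emit x.2.1) x.2.2 (ρ x.1)) =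
      Paper.seqOutput step (emit k) q (l.flatMap ρ) := by
    intro ρ k l
    induction l with
    | nil => intro q; rfl
    | cons c l ih =>
      intro q
      rw [List.flatMap_cons, seqOutput_append, ← ih]
      simp [path, Paper.seqOutput]
  have hfwd : ∀ p ρ', M'.Reach p ρ' → ∃ ρ, M.Reach p.1 ρ ∧
      p.2 = (fun c q => (ρ c).foldl step q) ∧
      ρ' = fun x => Paper.seqOutput step (emit x.2.1) x.2.2 (ρ x.1) := by
    intro p ρ' h
    induction h with
    | initial p hp => exact ⟨M.ini p.1, .initial _ hp.1, hp.2, rfl⟩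
    | step i ρ' _ ih =>
      obtain ⟨ρ, h1, h2, h3⟩ := ih
      obtain ⟨i, τ⟩ := i
      change τ = _ at h2
      subst h2 h3
      refine ⟨_, .step i ρ h1, ?_, ?_⟩
      · funext c q
        exact (foldl_flatMap_eq _ _ _ _).symm
      · funext x
        exact hpath _ _ _ _
  have hbwd : ∀ s ρ, M.Reach s ρ → M'.Reach (s, fun c q => (ρ c).foldl step q)
      fun x => Paper.seqOutput step (emit x.2.1) x.2.2 (ρ x.1) := by
    intro s ρ h
    induction h with
    | initial s hs => exact .initial (M := M') (s, _) ⟨hs, rfl⟩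
    | step i ρ _ ih =>
      have := RegisterMachine.Reach.step (M := M') (i, _) _ ih
      convert this using 1
      · refine Prod.ext rfl ?_
        funext c q
        exact foldl_flatMap_eq _ _ _ _
      · funext x
        exact (hpath _ _ _ _).symm
  refine ⟨M', Set.ext fun w => ⟨?_, ?_⟩⟩
  · rintro ⟨p, ρ', h, hp, rfl⟩
    obtain ⟨ρ, h1, h2, rfl⟩ := hfwd p ρ' h
    obtain ⟨s, τ⟩ := p
    change τ = _ at h2
    subst h2
    refine ⟨_, ⟨s, ρ, h1, hp.1, rfl⟩, ?_, ?_⟩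
    · intro k
      rw [foldl_flatMap_eq]
      exact hp.2 k
    · funext k
      exact hpath _ _ _ _
  · rintro ⟨_, ⟨s, ρ, h, hs, rfl⟩, hF, rfl⟩
    refine ⟨_, _, hbwd s ρ h, ⟨hs, fun k => ?_⟩, ?_⟩
    · have := hF k
      rwa [foldl_flatMap_eq] at this
    · funext k
      exact (hpath _ _ _ _).symm

theorem foldl_option_isSome {α : Type} (w : List (Option α)) :
    w.foldl (fun (b : Bool) a => b && a.isSome) true = true → ∃ v : List α, w = v.map some := by
  have hf : ∀ w : List (Option α), w.foldl (fun (b : Bool) a => b && a.isSome) false = false := by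
    intro w
    induction w with
    | nil => rfl
    | cons a w ih => simpa using ih
  induction w with
  | nil => exact fun _ => ⟨[], rfl⟩
  | cons a w ih =>
    intro h
    cases a with
    | none => simp [hf] at h
    | some a =>
      obtain ⟨v, rfl⟩ := ih (by simpa using h)
      exact ⟨a :: v, rfl⟩

theorem IsEDT0L.isTupleEDT0L {α : Type} {L : Language α} (hL : IsEDT0L L) :
    IsTupleEDT0L { w : Unit → List α | w () ∈ L } := by
  obtain ⟨S, rfl⟩ := hL
  have h := S.isTupleEDT0L_derived.seqOutput (K := Unit) (Q := Bool)
    (fun b a => b && a.isSome) (fun _ _ a => a.toList) id (fun _ => true) {true}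
  have hout : ∀ v : List α, Paper.seqOutput (fun (b : Bool) (a : Option α) => b && a.isSome)
      (fun _ a => a.toList) true (v.map some) = v := by
    intro v
    induction v with
    | nil => rfl
    | cons a v ih => simpa [Paper.seqOutput] using ih
  have hrun : ∀ v : List α,
      (v.map some).foldl (fun (b : Bool) (a : Option α) => b && a.isSome) true = true := by
    intro v
    induction v with
    | nil => rfl
    | cons a v ih => simpa using ih
  convert h using 1
  ext w
  constructor
  · rintro ⟨φs, hφ, hw⟩
    refine ⟨fun _ => (w ()).map some, ⟨φs, hφ, ?_⟩, fun _ => hrun _, ?_⟩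
    · funext _
      exact hw.symm
    · funext _
      exact (hout _).symm
  · rintro ⟨_, ⟨φs, hφ, rfl⟩, hF, rfl⟩
    obtain ⟨v, hv⟩ := foldl_option_isSome _ (hF ())
    refine ⟨φs, hφ, ?_⟩
    simp only [hv, hout]

/-- The counting of separators (modulo `k + 1`) used to extract a component of a tuple. -/
def hashStep {α : Type} (k : ℕ) (c : ZMod (k + 1)) (x : α ⊕ Unit) : ZMod (k + 1) :=
  Sum.elim (fun _ => c) (fun _ => c - 1) x

/-- The output of the component extraction: letters are kept only while the counter is `0`. -/
def hashEmit {α : Type} (k : ℕ) (c : ZMod (k + 1)) (x : α ⊕ Unit) : List α :=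
  Sum.elim (fun a => if c = 0 then [a] else []) (fun _ => []) x

theorem seqOutput_hash_block {α : Type} (k : ℕ) (c : ZMod (k + 1)) (l : List α)
    (v : List (α ⊕ Unit)) :
    seqOutput (hashStep k) (hashEmit k) c (l.map Sum.inl ++ v) =
      (if c = 0 then l else []) ++ seqOutput (hashStep k) (hashEmit k) c v := by
  induction l with
  | nil => simp
  | cons a l ih =>
    rw [List.map_cons, List.cons_append, seqOutput]
    simp only [hashStep, Sum.elim_inl] at ih ⊢
    rw [ih]
    by_cases hc : c = 0 <;> simp [hashEmit, hc]

theorem seqOutput_hash_eq_nil {α : Type} (k : ℕ) (ls : List (List α)) (c : ZMod (k + 1))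
    (hc : ∀ p < ls.length, c ≠ (p : ZMod (k + 1))) :
    seqOutput (hashStep k) (hashEmit k) c
      (List.intercalate [Sum.inr ()] (ls.map (List.map Sum.inl))) = [] := by
  induction ls generalizing c with
  | nil => rfl
  | cons l ls ih =>
    have hc0 : c ≠ 0 := by simpa using hc 0 (by simp)
    cases ls with
    | nil =>
      have := seqOutput_hash_block k c l []
      simpa [hc0, seqOutput] using this
    | cons l' ls =>
      have := ih (c - 1) (fun p hp h => hc (p + 1) (by simpa using hp) (by
        rw [sub_eq_iff_eq_add] at h
        simpa using h))
      rw [List.map_cons, List.map_cons, List.intercalate_cons_cons, List.append_assoc,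
        seqOutput_hash_block]
      simpa [hc0, seqOutput, hashEmit, hashStep] using this

theorem seqOutput_hash {α : Type} (k : ℕ) (ls : List (List α)) (hk : ls.length ≤ k) (j : ℕ)
    (hj : j < ls.length) :
    seqOutput (hashStep k) (hashEmit k) (j : ZMod (k + 1))
      (List.intercalate [Sum.inr ()] (ls.map (List.map Sum.inl))) = ls[j] := by
  have hne : ∀ p : ℕ, p < k → ((p : ZMod (k + 1)) + 1) ≠ 0 := by
    intro p hp h
    have : ((p + 1 : ℕ) : ZMod (k + 1)) = 0 := by exact_mod_cast h
    rw [ZMod.natCast_eq_zero_iff] at this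
    have := Nat.le_of_dvd (by omega) this
    omega
  induction ls generalizing j with
  | nil => simp at hj
  | cons l ls ih =>
    have hk' : ls.length < k := by simpa using hk
    cases ls with
    | nil =>
      obtain rfl : j = 0 := by simpa using hj
      have := seqOutput_hash_block k 0 l []
      simpa [seqOutput] using this
    | cons l' ls =>
      rw [List.map_cons, List.map_cons, List.intercalate_cons_cons, List.append_assoc,
        seqOutput_hash_block]
      cases j with
      | zero =>
        have := seqOutput_hash_eq_nil k (l' :: ls) (-1) (fun p hp h => hne p (by omega) (by
          rw [← h]
          simp))
        simpa [seqOutput, hashEmit, hashStep] using this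
      | succ j =>
        have hj' : j < (l' :: ls).length := by simpa using hj
        have := ih hk'.le j hj'
        have h0 := hne j (by omega)
        simpa [seqOutput, hashEmit, hashStep, h0] using this

/-- The set of tuples `a` is EDT0L if the language of the words `a₁#⋯#aₖ` is. -/
theorem IsTupleEDT0L.of_hashWord {α : Type} {k : ℕ} (A : Set (Fin k → List α))
    (h : IsEDT0L ({ w | ∃ a ∈ A, w = hashWord a } : Language (α ⊕ Unit))) : IsTupleEDT0L A := by
  have h := h.isTupleEDT0L.seqOutput (K := Fin k) (Q := ZMod (k + 1)) (hashStep k)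
    (fun _ => hashEmit k) (fun _ => ()) (fun j => ((j : ℕ) : ZMod (k + 1))) Set.univ
  have hout : ∀ (a : Fin k → List α) (j : Fin k), Paper.seqOutput (hashStep k) (hashEmit k)
      ((j : ℕ) : ZMod (k + 1)) (hashWord a) = a j := by
    intro a j
    have := seqOutput_hash k (List.ofFn a) (by simp) j (by simp)
    rw [List.map_ofFn] at this
    simpa [hashWord, Function.comp_def] using this
  convert h using 1
  ext w
  constructor
  · intro hw
    refine ⟨fun _ => hashWord w, ⟨w, hw, rfl⟩, fun _ => trivial, ?_⟩
    funext j
    exact (hout w j).symm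
  · rintro ⟨a, ⟨b, hb, hab⟩, -, rfl⟩
    simp only [hab, hout]
    exact hb

/-- Products of EDT0L sets of tuples are EDT0L. -/
theorem IsTupleEDT0L.pi {Ω β : Type} [Finite Ω] {J : Ω → Type}
    {A : ∀ ω, Set (J ω → List β)} (hA : ∀ ω, IsTupleEDT0L (A ω)) :
    IsTupleEDT0L { w : (Σ ω, J ω) → List β | ∀ ω, (fun j => w ⟨ω, j⟩) ∈ A ω } := by
  choose M hM using hA
  have := fun ω => (M ω).finσ
  have := fun ω => (M ω).finι
  have := fun ω => (M ω).finC
  let M' : RegisterMachine (Σ ω, J ω) β :=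
    { σ := ∀ ω, (M ω).σ, finσ := inferInstance
      ι := ∀ ω, (M ω).ι ⊕ (M ω).σ, finι := inferInstance
      C := Σ ω, (M ω).C, finC := inferInstance
      initial := {s | ∀ ω, s ω ∈ (M ω).initial}
      ini := fun s x => (M x.1).ini (s x.1) x.2
      src := fun i ω => Sum.elim (M ω).src id (i ω)
      tgt := fun i ω => Sum.elim (M ω).tgt id (i ω)
      upd := fun i x => (Sum.elim (fun t => (M x.1).upd t x.2) (fun _ => [x.2]) (i x.1)).map
        (Sigma.mk x.1)
      fin := {s | ∀ ω, s ω ∈ (M ω).fin}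
      out := fun s x => ((M x.1).out (s x.1) x.2).map (Sigma.mk x.1) }
  have hfwd : ∀ s ρ, M'.Reach s ρ → ∀ ω, (M ω).Reach (s ω) fun c => ρ ⟨ω, c⟩ := by
    intro s ρ h
    induction h with
    | initial s hs => exact fun ω => .initial _ (hs ω)
    | step i ρ _ ih =>
      intro ω
      have h1 := ih ω
      simp only [M', List.flatMap_map] at h1 ⊢
      cases hi : i ω with
      | inl t =>
        rw [hi] at h1
        exact .step t _ h1
      | inr s =>
        rw [hi] at h1
        simpa using h1
  have hbwd : ∀ n (s : ∀ ω, (M ω).σ) (ρ : M'.C → List β),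
      (∀ ω, (M ω).ReachIn n (s ω) fun c => ρ ⟨ω, c⟩) → M'.Reach s ρ := by
    intro n
    induction n with
    | zero =>
      intro s ρ h
      have h0 : ∀ ω, s ω ∈ (M ω).initial ∧ (fun c => ρ ⟨ω, c⟩) = (M ω).ini (s ω) := by
        intro ω
        have := h ω
        generalize (fun c => ρ ⟨ω, c⟩) = r at this
        cases this with
        | initial _ hs => exact ⟨hs, rfl⟩
      have : ρ = M'.ini s := by
        funext x
        exact congrFun (h0 x.1).2 x.2
      rw [this]
      exact .initial _ fun ω => (h0 ω).1
    | succ n ih =>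
      intro s ρ h
      have h1 : ∀ ω, ∃ (i : (M ω).ι ⊕ (M ω).σ) (r : (M ω).C → List β),
          (M ω).ReachIn n (Sum.elim (M ω).src id i) r ∧ s ω = Sum.elim (M ω).tgt id i ∧
          (fun c => ρ ⟨ω, c⟩) = fun c =>
            (Sum.elim (fun t => (M ω).upd t c) (fun _ => [c]) i).flatMap r := by
        intro ω
        have := h ω
        generalize (fun c => ρ ⟨ω, c⟩) = r at this
        generalize hsω : s ω = sω at this
        cases this with
        | step _ i r h => exact ⟨.inl i, r, h, rfl, rfl⟩
        | idle _ _ _ h => exact ⟨.inr sω, r, h, rfl, by simp⟩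
      choose i r h2 h3 h4 using h1
      have h5 := RegisterMachine.Reach.step (M := M') i (fun x => r x.1 x.2) (ih _ _ h2)
      convert h5 using 1
      · funext ω
        exact h3 ω
      · funext x
        have := congrFun (h4 x.1) x.2
        simpa [M', List.flatMap_map] using this
  refine ⟨M', Set.ext fun w => ⟨?_, ?_⟩⟩
  · rintro ⟨s, ρ, h, hs, rfl⟩ ω
    rw [← hM ω]
    refine ⟨_, _, hfwd s ρ h ω, hs ω, ?_⟩
    funext j
    simp [M', List.flatMap_map]
  · intro hw
    have h1 : ∀ ω, _ ∈ (M ω).tuples := fun ω => (hM ω).symm ▸ hw ω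
    choose s ρ h2 h3 h4 using h1
    choose n hn using fun ω => (h2 ω).exists_reachIn
    obtain ⟨N, hN⟩ := (Set.finite_range n).bddAbove
    refine ⟨s, fun x => ρ x.1 x.2,
      hbwd N _ _ fun ω => (hn ω).mono (hN ⟨ω, rfl⟩), h3, ?_⟩
    funext x
    have := congrFun (h4 x.1) x.2
    simpa [M', List.flatMap_map] using this

/-- Finite unions of EDT0L sets of tuples are EDT0L. -/
theorem IsTupleEDT0L.iUnion {T J β : Type} [Finite T] {A : T → Set (J → List β)}
    (hA : ∀ t, IsTupleEDT0L (A t)) : IsTupleEDT0L (⋃ t, A t) := by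
  classical
  choose M hM using hA
  have := fun t => (M t).finσ
  have := fun t => (M t).finι
  have := fun t => (M t).finC
  let M' : RegisterMachine J β :=
    { σ := Σ t, (M t).σ, finσ := inferInstance
      ι := Σ t, (M t).ι, finι := inferInstance
      C := Σ t, (M t).C, finC := inferInstance
      initial := {s | s.2 ∈ (M s.1).initial}
      ini := fun s x => if h : x.1 = s.1 then (M s.1).ini s.2 (h ▸ x.2) else []
      src := fun i => ⟨i.1, (M i.1).src i.2⟩
      tgt := fun i => ⟨i.1, (M i.1).tgt i.2⟩
      upd := fun i x => if h : x.1 = i.1 then ((M i.1).upd i.2 (h ▸ x.2)).map (Sigma.mk i.1) else []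
      fin := {s | s.2 ∈ (M s.1).fin}
      out := fun s j => ((M s.1).out s.2 j).map (Sigma.mk s.1) }
  have hfwd : ∀ s ρ, M'.Reach s ρ → (M s.1).Reach s.2 fun c => ρ ⟨s.1, c⟩ := by
    intro s ρ h
    induction h with
    | initial s hs => simpa [M'] using RegisterMachine.Reach.initial (M := M s.1) s.2 hs
    | step i ρ _ ih =>
      have := RegisterMachine.Reach.step i.2 _ ih
      simpa [M', List.flatMap_map] using this
  have hbwd : ∀ t s ρ, (M t).Reach s ρ →
      ∃ ρ' : M'.C → List β, M'.Reach ⟨t, s⟩ ρ' ∧ ∀ c, ρ' ⟨t, c⟩ = ρ c := by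
    intro t s ρ h
    induction h with
    | initial s hs => exact ⟨_, .initial (M := M') ⟨t, s⟩ hs, fun c => by simp [M']⟩
    | step i ρ _ ih =>
      obtain ⟨ρ', h1, h2⟩ := ih
      exact ⟨_, .step (M := M') ⟨t, i⟩ ρ' h1, fun c => by simp [M', List.flatMap_map, h2]⟩
  refine ⟨M', Set.ext fun w => ⟨?_, ?_⟩⟩
  · rintro ⟨s, ρ, h, hs, rfl⟩
    refine Set.mem_iUnion.2 ⟨s.1, ?_⟩
    rw [← hM s.1]
    refine ⟨_, _, hfwd s ρ h, hs, ?_⟩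
    funext j
    simp [M', List.flatMap_map]
  · intro hw
    obtain ⟨t, ht⟩ := Set.mem_iUnion.1 hw
    rw [← hM t] at ht
    obtain ⟨s, ρ, h, hs, rfl⟩ := ht
    obtain ⟨ρ', h1, h2⟩ := hbwd t s ρ h
    refine ⟨_, _, h1, hs, ?_⟩
    funext j
    simp [M', List.flatMap_map, h2]

/-- A function producing words from tuples of words by concatenating components and constants. -/
def IsTemplate {J β : Type} (f : (J → List β) → List β) : Prop :=
  ∃ u : List (J ⊕ β), ∀ a, f a = u.flatMap (Sum.elim a fun b => [b])

theorem IsTemplate.const {J β : Type} (w : List β) : IsTemplate fun _ : J → List β => w :=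
  ⟨w.map Sum.inr, fun a => by simp [List.flatMap_map]⟩

theorem IsTemplate.proj {J β : Type} (j : J) : IsTemplate fun a : J → List β => a j :=
  ⟨[Sum.inl j], fun a => by simp⟩

theorem IsTemplate.append {J β : Type} {f g : (J → List β) → List β} (hf : IsTemplate f)
    (hg : IsTemplate g) : IsTemplate fun a => f a ++ g a := by
  obtain ⟨u, hu⟩ := hf
  obtain ⟨v, hv⟩ := hg
  exact ⟨u ++ v, fun a => by simp [hu, hv]⟩

theorem IsTemplate.flatMap {I J β : Type} {f : I → (J → List β) → List β}
    (hf : ∀ i, IsTemplate (f i)) (l : List I) : IsTemplate fun a => l.flatMap fun i => f i a := by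
  induction l with
  | nil => exact .const []
  | cons i l ih => exact (hf i).append ih

theorem IsTemplate.intercalate {J β : Type} (sep : List β) (fs : List ((J → List β) → List β))
    (hfs : ∀ f ∈ fs, IsTemplate f) :
    IsTemplate fun a => List.intercalate sep (fs.map fun f => f a) := by
  induction fs with
  | nil => exact .const []
  | cons f fs ih =>
    cases fs with
    | nil => simpa using hfs f (by simp)
    | cons g fs =>
      have h1 := (hfs f (by simp)).append ((IsTemplate.const (J := J) sep).append
        (ih fun f' hf' => hfs f' (by simp_all)))
      simpa [List.intercalate_cons_cons] using h1

/-- EDT0L sets of tuples are closed under concatenating components and constants. -/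
theorem IsTupleEDT0L.template {J K β : Type} [Finite β] {A : Set (J → List β)}
    (hA : IsTupleEDT0L A) {f : K → (J → List β) → List β} (hf : ∀ k, IsTemplate (f k)) :
    IsTupleEDT0L { w : K → List β | ∃ a ∈ A, w = fun k => f k a } := by
  obtain ⟨M, rfl⟩ := hA
  choose u hu using hf
  have := M.finσ
  have := M.finι
  have := M.finC
  let M' : RegisterMachine K β :=
    { σ := M.σ, finσ := inferInstance, ι := M.ι, finι := inferInstance
      C := M.C ⊕ β, finC := inferInstance
      initial := M.initial, ini := fun s => Sum.elim (M.ini s) fun b => [b]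
      src := M.src, tgt := M.tgt
      upd := fun i => Sum.elim (fun c => (M.upd i c).map Sum.inl) fun b => [Sum.inr b]
      fin := M.fin
      out := fun s k => (u k).flatMap
        (Sum.elim (fun j => (M.out s j).map Sum.inl) fun b => [Sum.inr b]) }
  have hupd : ∀ i ρ, (fun c => (M'.upd i c).flatMap (Sum.elim ρ fun b => [b])) =
      Sum.elim (fun c => (M.upd i c).flatMap ρ) fun b => [b] := by
    intro i ρ
    funext x
    cases x <;> simp [M', List.flatMap_map]
  have hfwd : ∀ s ρ', M'.Reach s ρ' → ∃ ρ, M.Reach s ρ ∧ ρ' = Sum.elim ρ fun b => [b] := by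
    intro s ρ' h
    induction h with
    | initial s hs => exact ⟨_, .initial (M := M) s hs, rfl⟩
    | step i ρ' _ ih =>
      obtain ⟨ρ, h1, rfl⟩ := ih
      exact ⟨_, .step (M := M) i ρ h1, hupd i ρ⟩
  have hbwd : ∀ s ρ, M.Reach s ρ → M'.Reach s (Sum.elim ρ fun b => [b]) := by
    intro s ρ h
    induction h with
    | initial s hs => exact .initial (M := M') s hs
    | step i ρ _ ih =>
      rw [← hupd]
      exact .step (M := M') i _ ih
  have hout : ∀ s k (ρ : M.C → List β), (M'.out s k).flatMap (Sum.elim ρ fun b => [b]) =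
      f k fun j => (M.out s j).flatMap ρ := by
    intro s k ρ
    rw [hu]
    simp only [M', List.flatMap_assoc]
    congr 1
    funext x
    cases x <;> simp [List.flatMap_map]
  refine ⟨M', Set.ext fun w => ⟨?_, ?_⟩⟩
  · rintro ⟨s, ρ', h, hs, rfl⟩
    obtain ⟨ρ, h1, rfl⟩ := hfwd s ρ' h
    exact ⟨_, ⟨s, ρ, h1, hs, rfl⟩, funext fun k => hout s k ρ⟩
  · rintro ⟨_, ⟨s, ρ, h, hs, rfl⟩, rfl⟩
    exact ⟨_, _, hbwd s ρ h, hs, funext fun k => (hout s k ρ).symm⟩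

/-- The letterwise substitutions of the EDT0L system simulating a register machine: derivations
run through the computation of the machine backwards. -/
noncomputable def RegisterMachine.toTab {J β : Type} (M : RegisterMachine J β) (j : J) :
    M.σ ⊕ M.ι ⊕ M.σ → Option (M.C ⊕ β) → List (Option (M.C ⊕ β))
  | .inl s, none => (M.out s j).map fun c => some (.inl c)
  | .inr (.inl i), some (.inl c) => (M.upd i c).map fun c => some (.inl c)
  | .inr (.inr s), some (.inl c) => (M.ini s c).map fun b => some (.inr b)
  | _, x => [x]

open Classical in
/-- The automaton recognising the (reversed) computations of a register machine. Besides the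
states of the machine it has the states `0` (start), `1` (accepting) and `2` (sink). -/
noncomputable def RegisterMachine.toDFA {J β : Type} (M : RegisterMachine J β) :
    DFA (M.σ ⊕ M.ι ⊕ M.σ) (M.σ ⊕ Fin 3) where
  start := .inr 0
  accept := {.inr 1}
  step
    | .inr 0, .inl s => if s ∈ M.fin then .inl s else .inr 2
    | .inl s, .inr (.inl i) => if s = M.tgt i then .inl (M.src i) else .inr 2
    | .inl s, .inr (.inr s') => if s = s' ∧ s ∈ M.initial then .inr 1 else .inr 2
    | _, _ => .inr 2

theorem RegisterMachine.toDFA_evalFrom_sink {J β : Type} (M : RegisterMachine J β)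
    (x : List (M.σ ⊕ M.ι ⊕ M.σ)) : M.toDFA.evalFrom (.inr 2) x = .inr 2 := by
  induction x with
  | nil => rfl
  | cons a x ih => simpa [toDFA] using ih

theorem RegisterMachine.toDFA_evalFrom_accept {J β : Type} (M : RegisterMachine J β)
    (x : List (M.σ ⊕ M.ι ⊕ M.σ)) (h : M.toDFA.evalFrom (.inr 1) x = .inr 1) : x = [] := by
  cases x with
  | nil => rfl
  | cons a x =>
    have : M.toDFA.evalFrom (.inr 2) x = .inr 1 := by simpa [toDFA] using h
    rw [M.toDFA_evalFrom_sink] at this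
    simp at this

theorem IsTupleEDT0L.isEDT0L {J β : Type} [Finite β] {A : Set (J → List β)}
    (hA : IsTupleEDT0L A) (j : J) : IsEDT0L ({ w | ∃ a ∈ A, w = a j } : Language β) := by
  classical
  obtain ⟨M, rfl⟩ := hA
  have := M.finσ
  have := M.finι
  have := M.finC
  have := Fintype.ofFinite M.σ
  let S : EDT0LSystem β :=
    { C := Option (M.C ⊕ β), finC := Fintype.ofFinite _
      term := fun x => x.bind (Sum.elim (fun _ => none) some)
      term_inj := by rintro (_ | _ | _) (_ | _ | _) a <;> simp +contextual
      start := [none]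
      ι := M.σ ⊕ M.ι ⊕ M.σ, finι := Fintype.ofFinite _
      tab := M.toTab j
      control := M.toDFA.accepts
      control_reg := ⟨M.σ ⊕ Fin 3, inferInstance, M.toDFA, rfl⟩ }
  have happ : ∀ (x : List S.ι) (g : M.C → List β) (l : List M.C),
      (∀ c, S.apply x [some (.inl c)] = (g c).map fun b => some (.inr b)) →
      S.apply x (l.map fun c => some (.inl c)) = (l.flatMap g).map fun b => some (.inr b) := by
    intro x g l h
    rw [S.apply_eq_flatMap, List.flatMap_map, List.map_flatMap]
    simp only [h]
  have hfwd : ∀ (x : List S.ι) (s : M.σ), M.toDFA.evalFrom (.inl s) x = .inr 1 →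
      ∃ ρ, M.Reach s ρ ∧ ∀ c, S.apply x [some (.inl c)] = (ρ c).map fun b => some (.inr b) := by
    intro x
    induction x with
    | nil =>
      intro s h
      simp at h
    | cons a x ih =>
      intro s h
      rw [DFA.evalFrom_cons] at h
      have hsink := M.toDFA_evalFrom_sink x
      rcases a with t | i | t
      · simp [RegisterMachine.toDFA] at h hsink
        simp [hsink] at h
      · by_cases hs : s = M.tgt i
        · subst hs
          obtain ⟨ρ, h1, h2⟩ := ih (M.src i) (by simpa [RegisterMachine.toDFA] using h)
          refine ⟨_, .step i ρ h1, fun c => ?_⟩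
          rw [S.apply_cons, ← happ x ρ _ h2]
          simp [subApply, S, RegisterMachine.toTab]
        · simp [RegisterMachine.toDFA, hs] at h hsink
          simp [hsink] at h
      · by_cases hs : s = t ∧ s ∈ M.initial
        · obtain ⟨rfl, hs⟩ := hs
          have hx := M.toDFA_evalFrom_accept x (by simpa [RegisterMachine.toDFA, hs] using h)
          subst hx
          refine ⟨_, .initial s hs, fun c => ?_⟩
          rw [S.apply_cons]
          simp [subApply, S, RegisterMachine.toTab, EDT0LSystem.apply]
        · simp [RegisterMachine.toDFA, hs] at h hsink
          simp [hsink] at h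
  have hterm : ∀ (x : List S.ι) (b : β), S.apply x [some (.inr b)] = [some (.inr b)] := by
    intro x b
    induction x with
    | nil => rfl
    | cons a x ih =>
      rw [S.apply_cons]
      rcases a with t | i | t <;> simpa [subApply, S, RegisterMachine.toTab] using ih
  have hbwd : ∀ s ρ, M.Reach s ρ → ∃ x : List S.ι, M.toDFA.evalFrom (.inl s) x = .inr 1 ∧
      ∀ c, S.apply x [some (.inl c)] = (ρ c).map fun b => some (.inr b) := by
    intro s ρ h
    induction h with
    | initial s hs =>
      refine ⟨[.inr (.inr s)], by simp [RegisterMachine.toDFA, hs], fun c => ?_⟩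
      rw [S.apply_cons]
      simp [subApply, S, RegisterMachine.toTab, EDT0LSystem.apply]
    | step i ρ _ ih =>
      obtain ⟨x, h1, h2⟩ := ih
      refine ⟨.inr (.inl i) :: x, by simpa [RegisterMachine.toDFA] using h1, fun c => ?_⟩
      rw [S.apply_cons, ← happ x ρ _ h2]
      simp [subApply, S, RegisterMachine.toTab]
  have hterms : ∀ u v : List β,
      (u.map fun b => (some (.inr b) : Option (M.C ⊕ β))).map S.term = v.map some ↔ u = v := by
    intro u v
    have : (u.map fun b => (some (.inr b) : Option (M.C ⊕ β))).map S.term = u.map some := by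
      simp [S]
    rw [this]
    exact (List.map_injective_iff.2 (Option.some_injective β)).eq_iff
  refine ⟨S, Set.ext fun w => ⟨?_, ?_⟩⟩
  · rintro ⟨φs, hφ, hw⟩
    have hφ' : M.toDFA.evalFrom (.inr 0) φs = .inr 1 := hφ
    cases φs with
    | nil => simp at hφ'
    | cons a x =>
      have hsink := M.toDFA_evalFrom_sink x
      rw [DFA.evalFrom_cons] at hφ'
      rcases a with s | a
      · by_cases hs : s ∈ M.fin
        · obtain ⟨ρ, h1, h2⟩ := hfwd x s (by simpa [RegisterMachine.toDFA, hs] using hφ')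
          refine ⟨_, ⟨s, ρ, h1, hs, rfl⟩, ?_⟩
          rw [S.apply_cons] at hw
          have h3 := happ x ρ (M.out s j) h2
          have h4 : subApply (S.tab (.inl s)) S.start =
              (M.out s j).map fun c => some (.inl c) := by
            simp [subApply, S, RegisterMachine.toTab]
          rw [h4, h3, hterms] at hw
          exact hw.symm
        · simp [RegisterMachine.toDFA, hs] at hφ' hsink
          simp [hsink] at hφ'
      · simp [RegisterMachine.toDFA] at hφ' hsink
        simp [hsink] at hφ'
  · rintro ⟨_, ⟨s, ρ, h, hs, rfl⟩, rfl⟩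
    obtain ⟨x, h1, h2⟩ := hbwd s ρ h
    refine ⟨.inl s :: x, ?_, ?_⟩
    · change M.toDFA.evalFrom (.inr 0) (.inl s :: x) = .inr 1
      simpa [RegisterMachine.toDFA, hs] using h1
    · rw [S.apply_cons]
      have h3 := happ x ρ (M.out s j) h2
      have h4 : subApply (S.tab (.inl s)) S.start =
          (M.out s j).map fun c => some (.inl c) := by
        simp [subApply, S, RegisterMachine.toTab]
      rw [h4, h3, hterms]

/-- The group `W` admits a finite generating set and a normal form with respect to which the
solution language of every finite system of equations is EDT0L. -/
def HasEDT0LEquations (W : Type) [Group W] : Prop :=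
  ∃ (ι : Type) (_ : Fintype ι) (gen : ι → W) (η : W → List (ι × Bool)),
    Subgroup.closure (Set.range gen) = ⊤ ∧ (∀ w, evalWord gen (η w) = w) ∧
    ∀ (m : ℕ) (E : Set (Monoid.Coprod W (FreeGroup (Fin m)))), E.Finite →
      IsEDT0L (solutionLanguage η E)

section Words

variable {G ι : Type} [Group G] (gen : ι → G)

theorem evalWord_nil : evalWord gen [] = 1 := rfl

theorem evalWord_cons (a : ι × Bool) (w : List (ι × Bool)) :
    evalWord gen (a :: w) = evalWord gen [a] * evalWord gen w := by
  simp [evalWord]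

theorem evalWord_append (u v : List (ι × Bool)) :
    evalWord gen (u ++ v) = evalWord gen u * evalWord gen v := by
  simp [evalWord]

theorem evalWord_flatMap {I : Type} (l : List I) (f : I → List (ι × Bool)) :
    evalWord gen (l.flatMap f) = (l.map fun i => evalWord gen (f i)).prod := by
  induction l with
  | nil => rfl
  | cons i l ih => simp [evalWord_append, ih]

theorem evalWord_mem_closure (w : List (ι × Bool)) :
    evalWord gen w ∈ Subgroup.closure (Set.range gen) := by
  refine Subgroup.list_prod_mem _ fun x hx => ?_
  obtain ⟨a, -, rfl⟩ := List.mem_map.1 hx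
  have := Subgroup.subset_closure (Set.mem_range_self (f := gen) a.1)
  split_ifs
  · exact this
  · exact inv_mem this

theorem closure_range_eq_top_of_evalWord (η : G → List (ι × Bool))
    (h : ∀ g, evalWord gen (η g) = g) : Subgroup.closure (Set.range gen) = ⊤ :=
  (Subgroup.eq_top_iff' _).2 fun g => h g ▸ evalWord_mem_closure gen (η g)

/-- The transitions of the coset automaton of a normal subgroup `V`. -/
def cosetStep (V : Subgroup G) [V.Normal] (q : G ⧸ V) (a : ι × Bool) : G ⧸ V :=
  q * (evalWord gen [a] : G)

theorem foldl_cosetStep (V : Subgroup G) [V.Normal] (q : G ⧸ V) (w : List (ι × Bool)) :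
    w.foldl (cosetStep gen V) q = q * (evalWord gen w : G) := by
  induction w generalizing q with
  | nil => simp [evalWord_nil]
  | cons a w ih =>
    rw [List.foldl_cons, ih, evalWord_cons, cosetStep, QuotientGroup.mk_mul, mul_assoc]

/-- A transversal of a normal subgroup in which the trivial coset is represented by `1`. -/
noncomputable def cosetRep (V : Subgroup G) [V.Normal] (q : G ⧸ V) : G :=
  open Classical in if q = 1 then 1 else q.out

theorem mk_cosetRep (V : Subgroup G) [V.Normal] (q : G ⧸ V) :
    ((cosetRep V q : G) : G ⧸ V) = q := by
  by_cases h : q = 1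
  · simp [cosetRep, h]
  · simp [cosetRep, h]

theorem cosetRep_one (V : Subgroup G) [V.Normal] : cosetRep V 1 = 1 := by
  simp [cosetRep]

/-- The Schreier generator of `V` read by the coset automaton on the letter `a` from `q`. -/
noncomputable def schreierGen (V : Subgroup G) [V.Normal] (q : G ⧸ V) (a : ι × Bool) : V :=
  ⟨cosetRep V q * evalWord gen [a] * (cosetRep V (cosetStep gen V q a))⁻¹, by
    rw [← QuotientGroup.eq_one_iff]
    simp [mk_cosetRep, cosetStep]⟩

end Words

theorem seqOutput_map {Q α β γ : Type} (step : Q → α → Q) (emit : Q → α → List β) (f : β → γ)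
    (q : Q) (w : List α) :
    (seqOutput step emit q w).map f = seqOutput step (fun q a => (emit q a).map f) q w := by
  induction w generalizing q with
  | nil => rfl
  | cons a w ih => simp [seqOutput, ih]

/-- Evaluating the Schreier rewriting of a word. -/
theorem evalWord_seqOutput_cosetStep {W ι G ι' : Type} [Group W] [Group G] (gen : ι → W)
    (V : Subgroup W) [V.Normal] (gen' : ι' → G) (φ : V →* G)
    (letter : W ⧸ V → ι × Bool → ι')
    (hletter : ∀ q a, gen' (letter q a) = φ (schreierGen gen V q a))
    (w : List (ι × Bool)) (y : V) (hy : evalWord gen w = y) :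
    evalWord gen' (seqOutput (cosetStep gen V) (fun q a => [(letter q a, true)]) 1 w) = φ y := by
  have key : ∀ (w : List (ι × Bool)) (q : W ⧸ V), ∃ v : V,
      (v : W) = cosetRep V q * evalWord gen w * (cosetRep V (w.foldl (cosetStep gen V) q))⁻¹ ∧
      evalWord gen' (seqOutput (cosetStep gen V) (fun q a => [(letter q a, true)]) q w) = φ v := by
    intro w
    induction w with
    | nil =>
      intro q
      exact ⟨1, by simp [evalWord_nil], by simp [seqOutput, evalWord_nil]⟩
    | cons a w ih =>
      intro q
      obtain ⟨v, h1, h2⟩ := ih (cosetStep gen V q a)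
      refine ⟨schreierGen gen V q a * v, ?_, ?_⟩
      · rw [Subgroup.coe_mul, h1, schreierGen, List.foldl_cons, evalWord_cons gen a w]
        group
      · rw [seqOutput, evalWord_append, h2, map_mul, ← hletter]
        simp [evalWord]
  obtain ⟨v, h1, h2⟩ := key w 1
  rw [h2]
  congr 1
  ext
  have hyV : ((y : W) : W ⧸ V) = 1 := (QuotientGroup.eq_one_iff _).2 y.2
  rw [h1, foldl_cosetStep, hy, hyV]
  simp [cosetRep_one]

/-- The tuples of Schreier rewritings of solutions in `V` of a system of equations over `W`. -/
theorem isTupleEDT0L_schreier {W ι β : Type} [Group W] (gen : ι → W)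
    (η : W → List (ι × Bool)) (hη : ∀ w, evalWord gen (η w) = w) (V : Subgroup W) [V.Normal]
    [V.FiniteIndex] {k : ℕ} (E : Set (Monoid.Coprod W (FreeGroup (Fin k))))
    (hE : IsEDT0L (solutionLanguage η E)) (emit : Fin k → W ⧸ V → ι × Bool → List β) :
    IsTupleEDT0L { w : Fin k → List β | ∃ y : Fin k → W, SolvesSystem E y ∧ (∀ j, y j ∈ V) ∧
      w = fun j => seqOutput (cosetStep gen V) (emit j) 1 (η (y j)) } := by
  have h1 : IsTupleEDT0L { a : Fin k → List (ι × Bool) |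
      ∃ y : Fin k → W, SolvesSystem E y ∧ a = fun j => η (y j) } := by
    refine .of_hashWord _ ?_
    suffices h : ({ w | ∃ a ∈ { a : Fin k → List (ι × Bool) | ∃ y : Fin k → W,
        SolvesSystem E y ∧ a = fun j => η (y j) }, w = hashWord a } :
        Language ((ι × Bool) ⊕ Unit)) = solutionLanguage η E by
      rw [h]
      exact hE
    refine Set.ext fun w => ?_
    constructor
    · rintro ⟨_, ⟨y, hy, rfl⟩, rfl⟩
      exact ⟨y, hy, fun _ => trivial, rfl⟩
    · rintro ⟨y, hy, -, rfl⟩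
      exact ⟨_, ⟨y, hy, rfl⟩, rfl⟩
  have h2 := h1.seqOutput (cosetStep gen V) emit id (fun _ => 1) {1}
  have hmem : ∀ y : W, (η y).foldl (cosetStep gen V) 1 ∈ ({1} : Set (W ⧸ V)) ↔ y ∈ V := by
    intro y
    rw [foldl_cosetStep, hη, one_mul, Set.mem_singleton_iff, QuotientGroup.eq_one_iff]
  suffices h : { w : Fin k → List β | ∃ y : Fin k → W, SolvesSystem E y ∧ (∀ j, y j ∈ V) ∧
      w = fun j => seqOutput (cosetStep gen V) (emit j) 1 (η (y j)) } = _ by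
    rw [h]
    exact h2
  refine Set.ext fun w => ?_
  constructor
  · rintro ⟨y, hy, hV, rfl⟩
    exact ⟨_, ⟨y, hy, rfl⟩, fun j => (hmem _).2 (hV j), rfl⟩
  · rintro ⟨_, ⟨y, hy, rfl⟩, hV, rfl⟩
    exact ⟨y, hy, fun j => (hmem _).1 (hV j), rfl⟩

section Cocycle

variable {G W J : Type} [Group G] [Group W] [MulAction G J] (κ : J → G → W)
  (hκ : ∀ i g h, κ i (g * h) = κ (h • i) g * κ i h)

include hκ

theorem cocycle_one (i : J) : κ i 1 = 1 := by
  have := hκ i 1 1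
  simpa using this

theorem cocycle_inv (i : J) (g : G) : κ i g⁻¹ = (κ (g⁻¹ • i) g)⁻¹ := by
  have := hκ i g g⁻¹
  rw [mul_inv_cancel, cocycle_one κ hκ] at this
  exact eq_inv_of_mul_eq_one_right this.symm

/-- Each coordinate `κ i` of an equation over `G`, once the cosets `τ` of the variables modulo
`P` are fixed, is an equation over `W` in the coordinates of the `P`-parts of the variables. -/
theorem exists_cocycle_equation (P : Subgroup G) [P.Normal]
    (htriv : ∀ x ∈ P, ∀ i : J, x • i = i) (T : G ⧸ P → G) (hT : ∀ q, (T q : G ⧸ P) = q)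
    {m k : ℕ} (ε : Fin m × J ≃ Fin k) (τ : Fin m → G ⧸ P)
    (e : Monoid.Coprod G (FreeGroup (Fin m))) :
    ∃ E : J → Monoid.Coprod W (FreeGroup (Fin k)), ∀ g : Fin m → G, (∀ v, (g v : G ⧸ P) = τ v) →
      ∀ i, κ i (Monoid.Coprod.lift (MonoidHom.id G) (FreeGroup.lift g) e) =
        Monoid.Coprod.lift (MonoidHom.id W) (FreeGroup.lift fun x =>
          κ (ε.symm x).2 ((T (τ (ε.symm x).1))⁻¹ * g (ε.symm x).1)) (E i) := by
  let evQ : Monoid.Coprod G (FreeGroup (Fin m)) →* G ⧸ P :=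
    Monoid.Coprod.lift (QuotientGroup.mk' P) (FreeGroup.lift τ)
  have hact : ∀ a b : G, (a : G ⧸ P) = b → ∀ i : J, a • i = b • i := by
    intro a b hab i
    have := htriv _ (QuotientGroup.eq.1 hab) i
    rw [mul_smul, inv_smul_eq_iff] at this
    exact this.symm
  have hevQ : ∀ (g : Fin m → G), (∀ v, (g v : G ⧸ P) = τ v) → ∀ e,
      ((Monoid.Coprod.lift (MonoidHom.id G) (FreeGroup.lift g) e : G) : G ⧸ P) = T (evQ e) := by
    intro g hg e
    rw [hT]
    have : (QuotientGroup.mk' P).comp (Monoid.Coprod.lift (MonoidHom.id G) (FreeGroup.lift g)) =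
        evQ := by
      refine Monoid.Coprod.hom_ext ?_ ?_
      · ext
        simp [evQ]
      · ext v
        simp [evQ, hg]
    exact DFunLike.congr_fun this e
  have hmul : ∀ e₁ e₂ : Monoid.Coprod G (FreeGroup (Fin m)),
      (∃ E : J → Monoid.Coprod W (FreeGroup (Fin k)), ∀ g : Fin m → G,
        (∀ v, (g v : G ⧸ P) = τ v) →
        ∀ i, κ i (Monoid.Coprod.lift (MonoidHom.id G) (FreeGroup.lift g) e₁) =
        Monoid.Coprod.lift (MonoidHom.id W) (FreeGroup.lift fun x =>
          κ (ε.symm x).2 ((T (τ (ε.symm x).1))⁻¹ * g (ε.symm x).1)) (E i)) →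
      (∃ E : J → Monoid.Coprod W (FreeGroup (Fin k)), ∀ g : Fin m → G,
        (∀ v, (g v : G ⧸ P) = τ v) →
        ∀ i, κ i (Monoid.Coprod.lift (MonoidHom.id G) (FreeGroup.lift g) e₂) =
        Monoid.Coprod.lift (MonoidHom.id W) (FreeGroup.lift fun x =>
          κ (ε.symm x).2 ((T (τ (ε.symm x).1))⁻¹ * g (ε.symm x).1)) (E i)) →
      ∃ E : J → Monoid.Coprod W (FreeGroup (Fin k)), ∀ g : Fin m → G,
        (∀ v, (g v : G ⧸ P) = τ v) →
        ∀ i, κ i (Monoid.Coprod.lift (MonoidHom.id G) (FreeGroup.lift g) (e₁ * e₂)) =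
        Monoid.Coprod.lift (MonoidHom.id W) (FreeGroup.lift fun x =>
          κ (ε.symm x).2 ((T (τ (ε.symm x).1))⁻¹ * g (ε.symm x).1)) (E i) := by
    rintro e₁ e₂ ⟨E₁, h₁⟩ ⟨E₂, h₂⟩
    refine ⟨fun i => E₁ (T (evQ e₂) • i) * E₂ i, fun g hg i => ?_⟩
    rw [map_mul, hκ, map_mul, ← h₁ g hg, ← h₂ g hg, hact _ _ (hevQ g hg e₂)]
  induction e using Monoid.Coprod.induction_on with
  | inl a => exact ⟨fun i => Monoid.Coprod.inl (κ i a), fun g hg i => by simp⟩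
  | mul e₁ e₂ h₁ h₂ => exact hmul e₁ e₂ h₁ h₂
  | inr f =>
    induction f using FreeGroup.induction_on with
    | C1 => exact ⟨fun _ => 1, fun g hg i => by simp [cocycle_one κ hκ]⟩
    | of v =>
      refine ⟨fun i => Monoid.Coprod.inl (κ i (T (τ v))) *
        Monoid.Coprod.inr (FreeGroup.of (ε (v, i))), fun g hg i => ?_⟩
      have hP : (T (τ v))⁻¹ * g v ∈ P := by
        rw [← QuotientGroup.eq, hT, hg]
      have := hκ i (T (τ v)) ((T (τ v))⁻¹ * g v)
      rw [htriv _ hP, mul_inv_cancel_left] at this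
      simpa using this
    | inv_of v h =>
      obtain ⟨E, hE⟩ := h
      refine ⟨fun i => (E ((T (evQ (Monoid.Coprod.inr (FreeGroup.of v))))⁻¹ • i))⁻¹,
        fun g hg i => ?_⟩
      have h1 := hevQ g hg (Monoid.Coprod.inr (FreeGroup.of v))
      have h2 : ∀ a b : G, (a : G ⧸ P) = b → (a⁻¹ : G) • i = b⁻¹ • i := by
        intro a b hab
        exact hact _ _ (by rw [QuotientGroup.mk_inv, hab, QuotientGroup.mk_inv]) i
      rw [map_inv, map_inv, cocycle_inv κ hκ, h2 _ _ h1, hE g hg, map_inv]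
    | mul a b ha hb =>
      rw [map_mul]
      exact hmul _ _ ha hb

end Cocycle

theorem prod_map_mulSingle {I : Type} [Fintype I] [DecidableEq I] {M : I → Type}
    [∀ i, Group (M i)] (f : ∀ i, M i) :
    ((Finset.univ : Finset I).toList.map fun i => Pi.mulSingle i (f i)).prod = f := by
  ext p
  have h := map_list_prod (Pi.evalMonoidHom M p)
    ((Finset.univ : Finset I).toList.map fun i => Pi.mulSingle i (f i))
  rw [List.map_map] at h
  refine h.trans ?_
  rw [List.prod_map_eq_pow_single p]
  · rw [List.count_eq_one_of_mem (Finset.nodup_toList _) (by simp)]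
    simp
  · intro i hi _
    simp [Pi.mulSingle_eq_of_ne hi.symm]

section CocycleGroup

variable {G : Type} [Group G] (P : Subgroup G) [P.Normal] [P.FiniteIndex]
  {Ω : Type} [Finite Ω] (J : Ω → Type) [∀ ω, Finite (J ω)] [∀ ω, MulAction G (J ω)]
  (W : Ω → Type) [∀ ω, Group (W ω)] (V : ∀ ω, Subgroup (W ω)) [∀ ω, (V ω).Normal]
  [∀ ω, (V ω).FiniteIndex] (κ : ∀ ω, J ω → G → W ω)
  (hκ : ∀ ω i g h, κ ω i (g * h) = κ ω (h • i) g * κ ω i h)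
  (htriv : ∀ ω, ∀ x ∈ P, ∀ i : J ω, x • i = i)
  (Φ : P ≃* ∀ p : (Σ ω, J ω), V p.1)
  (hΦ : ∀ (x : P) (p : Σ ω, J ω), κ p.1 p.2 (x : G) = (Φ x p : W p.1))

omit [P.FiniteIndex] [Finite Ω] [∀ ω, (V ω).Normal] [∀ ω, (V ω).FiniteIndex] in
include hκ htriv hΦ in
/-- The solutions, with variables in prescribed cosets `τ` of `P`, of a system of equations
over `G` are described coordinatewise by finite systems of equations over the `W ω`. -/
theorem exists_cocycle_system {m : ℕ} (k : Ω → ℕ) (ε : ∀ ω, Fin m × J ω ≃ Fin (k ω))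
    (T : G ⧸ P → G) (hT : ∀ q, (T q : G ⧸ P) = q)
    (E : Set (Monoid.Coprod G (FreeGroup (Fin m)))) (hE : E.Finite) (τ : Fin m → G ⧸ P)
    (hτ : ∀ e ∈ E, Monoid.Coprod.lift (QuotientGroup.mk' P) (FreeGroup.lift τ) e = 1) :
    ∃ S : ∀ ω, Set (Monoid.Coprod (W ω) (FreeGroup (Fin (k ω)))), (∀ ω, (S ω).Finite) ∧
      ∀ g : Fin m → G, (∀ v, (g v : G ⧸ P) = τ v) → (SolvesSystem E g ↔ ∀ ω,
        SolvesSystem (S ω) fun x =>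
          κ ω ((ε ω).symm x).2 ((T (τ ((ε ω).symm x).1))⁻¹ * g ((ε ω).symm x).1)) := by
  choose S hS using fun ω e => exists_cocycle_equation (κ ω) (hκ ω) P (htriv ω) T hT (ε ω) τ e
  refine ⟨fun ω => (fun p : _ × J ω => S ω p.1 p.2) '' (E ×ˢ Set.univ),
    fun ω => (hE.prod Set.finite_univ).image _, fun g hg => ?_⟩
  have hP : ∀ e ∈ E, Monoid.Coprod.lift (MonoidHom.id G) (FreeGroup.lift g) e ∈ P := by
    intro e he
    rw [← QuotientGroup.eq_one_iff, ← hτ e he]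
    have : (QuotientGroup.mk' P).comp (Monoid.Coprod.lift (MonoidHom.id G) (FreeGroup.lift g)) =
        Monoid.Coprod.lift (QuotientGroup.mk' P) (FreeGroup.lift τ) := by
      refine Monoid.Coprod.hom_ext ?_ ?_
      · ext
        simp
      · ext v
        simp [hg]
    exact DFunLike.congr_fun this e
  have hone : ∀ x : P, (x : G) = 1 ↔ ∀ (ω) (i : J ω), κ ω i (x : G) = 1 := by
    intro x
    rw [OneMemClass.coe_eq_one, ← Φ.map_eq_one_iff, funext_iff, Sigma.forall]
    refine forall_congr' fun ω => forall_congr' fun i => ?_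
    rw [hΦ x ⟨ω, i⟩, OneMemClass.coe_eq_one, Pi.one_apply]
  constructor
  · rintro h ω _ ⟨⟨e, i⟩, ⟨he, -⟩, rfl⟩
    rw [← hS ω e g hg i]
    exact (hone ⟨_, hP e he⟩).1 (h e he) ω i
  · intro h e he
    refine (hone ⟨_, hP e he⟩).2 fun ω i => ?_
    refine (hS ω e g hg i).trans (h ω _ ⟨(e, i), ⟨he, trivial⟩, rfl⟩)

include κ hκ htriv Φ hΦ in
/-- If the coordinates of a finite index normal subgroup `P` of `G` extend to cocycles on `G` with
values in groups whose systems of equations have EDT0L solution languages, then systems of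
equations over `G` have EDT0L solution languages. -/
theorem hasEDT0LEquations_of_cocycle (hW : ∀ ω, HasEDT0LEquations (W ω)) :
    HasEDT0LEquations G := by
  classical
  have := Fintype.ofFinite (Σ ω, J ω)
  choose ι fι gen η hgen hη hsol using hW
  let T : G ⧸ P → G := Quotient.out
  have hT : ∀ q, (T q : G ⧸ P) = q := fun q => Quotient.out_eq' q
  let rest : G → P := fun g => ⟨(T g)⁻¹ * g, by rw [← QuotientGroup.eq, hT]⟩
  let L := (Σ p : (Σ ω, J ω), (W p.1 ⧸ V p.1) × (ι p.1 × Bool)) ⊕ (G ⧸ P)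
  let genG : L → G := Sum.elim
    (fun l => (Φ.symm (Pi.mulSingle l.1 (schreierGen (gen l.1.1) (V l.1.1) l.2.1 l.2.2)) : G)) T
  let emit : ∀ p : (Σ ω, J ω), W p.1 ⧸ V p.1 → ι p.1 × Bool → List (L × Bool) :=
    fun p q a => [(Sum.inl ⟨p, q, a⟩, true)]
  let word : ∀ p : (Σ ω, J ω), W p.1 → List (L × Bool) := fun p y =>
    Paper.seqOutput (cosetStep (gen p.1) (V p.1)) (emit p) 1 (η p.1 y)
  let ηG : G → List (L × Bool) := fun g => (Sum.inr (g : G ⧸ P), true) ::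
    Finset.univ.toList.flatMap fun p => word p (Φ (rest g) p : W p.1)
  have hword : ∀ (p : Σ ω, J ω) (y : V p.1),
      evalWord genG (word p y) = Φ.symm (Pi.mulSingle p y) := by
    intro p y
    exact evalWord_seqOutput_cosetStep (gen p.1) (V p.1) genG
      ((P.subtype.comp Φ.symm.toMonoidHom).comp
        (MonoidHom.mulSingle (fun p : (Σ ω, J ω) => ↥(V p.1)) p))
      (fun q a => Sum.inl ⟨p, q, a⟩) (fun q a => rfl) _ y (hη _ _)
  have hηG : ∀ g, evalWord genG (ηG g) = g := by
    intro g
    have h1 : ((Finset.univ : Finset (Σ ω, J ω)).toList.map fun p =>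
        evalWord genG (word p (Φ (rest g) p : W p.1))).prod = (rest g : G) := by
      have h2 := congrArg (fun f => (P.subtype.comp Φ.symm.toMonoidHom) f)
        (prod_map_mulSingle (Φ (rest g)))
      simp only [map_list_prod, List.map_map] at h2
      refine Eq.trans ?_ (h2.trans ?_)
      · congr 1
        refine List.map_congr_left fun p _ => ?_
        exact hword p _
      · simp
    rw [evalWord_cons, evalWord_flatMap, h1]
    simp [evalWord, genG, rest]
  have : ∀ ω, Finite (W ω ⧸ V ω) := fun ω => inferInstance
  have : Finite (G ⧸ P) := inferInstance
  have : Finite L := inferInstance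
  refine ⟨L, Fintype.ofFinite L, genG, ηG, closure_range_eq_top_of_evalWord genG ηG hηG, hηG, ?_⟩
  intro m E hE
  let ε : ∀ ω, Fin m × J ω ≃ Fin (Nat.card (Fin m × J ω)) := fun ω => Finite.equivFin _
  let Tp := { τ : Fin m → G ⧸ P //
    ∀ e ∈ E, Monoid.Coprod.lift (QuotientGroup.mk' P) (FreeGroup.lift τ) e = 1 }
  choose S hSfin hS using fun τ : Tp => exists_cocycle_system P J W V κ hκ htriv Φ hΦ
    (fun ω => Nat.card (Fin m × J ω)) ε T hT E hE τ.1 τ.2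
  have h1 := fun (τ : Tp) (ω : Ω) => isTupleEDT0L_schreier (β := (L × Bool) ⊕ Unit)
    (gen ω) (η ω) (hη ω) (V ω) (S τ ω) (hsol ω _ (S τ ω) (hSfin τ ω))
    (fun j q a => (emit ⟨ω, ((ε ω).symm j).2⟩ q a).map Sum.inl)
  have h2 := fun τ : Tp => IsTupleEDT0L.pi (h1 τ)
  let comp : Tp → Fin m → ((Σ ω, Fin (Nat.card (Fin m × J ω))) → List ((L × Bool) ⊕ Unit)) →
      List ((L × Bool) ⊕ Unit) := fun τ v a => [Sum.inl (Sum.inr (τ.1 v), true)] ++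
    (Finset.univ : Finset (Σ ω, J ω)).toList.flatMap fun p => a ⟨p.1, ε p.1 (v, p.2)⟩
  let f : Tp → Unit → ((Σ ω, Fin (Nat.card (Fin m × J ω))) → List ((L × Bool) ⊕ Unit)) →
      List ((L × Bool) ⊕ Unit) := fun τ _ a =>
    List.intercalate [Sum.inr ()] ((List.ofFn (comp τ)).map fun c => c a)
  have hf : ∀ τ k, IsTemplate (f τ k) := by
    intro τ _
    refine IsTemplate.intercalate _ _ fun c hc => ?_
    obtain ⟨v, rfl⟩ := (List.mem_ofFn' _ _).1 hc
    exact (IsTemplate.const _).append (IsTemplate.flatMap (fun p => IsTemplate.proj _) _)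
  have h3 := (IsTupleEDT0L.iUnion fun τ : Tp => (h2 τ).template (hf τ)).isEDT0L ()
  suffices h : ({ w | ∃ a ∈ (_ : Set (Unit → List ((L × Bool) ⊕ Unit))), w = a () } :
       Language ((L × Bool) ⊕ Unit)) =
      solutionLanguage ηG E by
    rw [← h]
    exact h3
  have hfword : ∀ (τ : Tp) (g : Fin m → G), (∀ v, (g v : G ⧸ P) = τ.1 v) →
      ∀ a : (Σ ω, Fin (Nat.card (Fin m × J ω))) → List ((L × Bool) ⊕ Unit),
      (∀ ω x, a ⟨ω, x⟩ = (word ⟨ω, ((ε ω).symm x).2⟩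
        (κ ω ((ε ω).symm x).2 ((T (τ.1 ((ε ω).symm x).1))⁻¹ * g ((ε ω).symm x).1))).map Sum.inl) →
      f τ () a = hashWord fun v => ηG (g v) := by
    intro τ g hg a ha
    simp only [f, hashWord, List.map_ofFn]
    congr 2
    funext v
    simp only [Function.comp, comp, ηG, List.map_cons, List.map_flatMap, hg, ha,
      List.singleton_append]
    congr 2
    funext p
    have hx : ∀ x : Fin m × J p.1, x = (v, p.2) → ∀ z, word ⟨p.1, x.2⟩
        (κ p.1 x.2 ((T (τ.1 x.1))⁻¹ * g x.1)) = z →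
        word p (κ p.1 p.2 ((T (τ.1 v))⁻¹ * g v)) = z := by
      rintro _ rfl z h
      exact h
    rw [← hΦ, ← hx _ ((ε p.1).symm_apply_apply (v, p.2)) _ rfl]
    simp [rest, hg]
  refine Set.ext fun w => ?_
  constructor
  · rintro ⟨a, ha, rfl⟩
    obtain ⟨τ, b, hb, rfl⟩ := Set.mem_iUnion.1 ha
    choose y hy hyV hyb using hb
    let x : Fin m → P := fun v => Φ.symm fun p => ⟨y p.1 (ε p.1 (v, p.2)), hyV _ _⟩
    have hxy : ∀ ω j, κ ω ((ε ω).symm j).2 (x ((ε ω).symm j).1 : G) = y ω j := by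
      intro ω j
      rw [hΦ (x _) ⟨ω, _⟩]
      simp [x]
    have hg : ∀ v, ((T (τ.1 v) * x v : G) : G ⧸ P) = τ.1 v := by
      intro v
      rw [QuotientGroup.mk_mul_of_mem _ (x v).2, hT]
    refine ⟨fun v => T (τ.1 v) * x v, (hS τ _ hg).2 fun ω => ?_, fun _ => trivial, ?_⟩
    · simp only [inv_mul_cancel_left, hxy]
      exact hy ω
    · refine hfword τ _ hg b fun ω j => ?_
      simp only [inv_mul_cancel_left, hxy]
      rw [congrFun (hyb ω) j, seqOutput_map]
  · rintro ⟨g, hg, -, rfl⟩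
    have hτ : ∀ e ∈ E, Monoid.Coprod.lift (QuotientGroup.mk' P)
        (FreeGroup.lift fun v => (g v : G ⧸ P)) e = 1 := by
      intro e he
      have : (QuotientGroup.mk' P).comp
          (Monoid.Coprod.lift (MonoidHom.id G) (FreeGroup.lift g)) =
          Monoid.Coprod.lift (QuotientGroup.mk' P) (FreeGroup.lift fun v => (g v : G ⧸ P)) := by
        refine Monoid.Coprod.hom_ext ?_ ?_
        · ext
          simp
        · ext v
          simp
      rw [← this, MonoidHom.comp_apply, hg e he, map_one]
    let τ : Tp := ⟨fun v => (g v : G ⧸ P), hτ⟩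
    refine ⟨_, Set.mem_iUnion.2 ⟨τ, fun s => (word ⟨s.1, ((ε s.1).symm s.2).2⟩
      (κ s.1 ((ε s.1).symm s.2).2
        ((T (τ.1 ((ε s.1).symm s.2).1))⁻¹ * g ((ε s.1).symm s.2).1))).map Sum.inl,
      fun ω => ⟨_, (hS τ g fun _ => rfl).1 hg ω, fun j => ?_, ?_⟩, rfl⟩,
      (hfword τ g (fun _ => rfl) _ fun _ _ => rfl).symm⟩
    · have := hΦ (rest (g ((ε ω).symm j).1)) ⟨ω, ((ε ω).symm j).2⟩
      simp only [rest] at this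
      simp only [τ, this]
      exact SetLike.coe_mem _
    · funext j
      rw [← seqOutput_map]

end CocycleGroup

section Action

open MulAction

theorem bijective_sigma_orbit_coe (G 𝒳 : Type) [Group G] [MulAction G 𝒳] :
    Function.Bijective fun p : Σ ω : orbitRel.Quotient G 𝒳, orbit G ω.out => (p.2 : 𝒳) := by
  have hmk : ∀ p : Σ ω : orbitRel.Quotient G 𝒳, orbit G ω.out,
      p.1 = Quotient.mk (orbitRel G 𝒳) (p.2 : 𝒳) := fun p =>
    (Quotient.out_eq p.1).symm.trans (Quotient.sound p.2.2).symm
  constructor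
  · intro p q h
    have h1 := hmk p
    have h2 := hmk q
    rw [show (p.2 : 𝒳) = q.2 from h, ← h2] at h1
    obtain ⟨ω, i⟩ := p
    obtain ⟨ω', j⟩ := q
    obtain rfl : ω = ω' := h1
    obtain rfl : i = j := Subtype.ext h
    rfl
  · intro i
    exact ⟨⟨Quotient.mk _ i, ⟨i, (orbitRel G 𝒳).symm (Quotient.mk_out (s := orbitRel G 𝒳) i)⟩⟩, rfl⟩

/-- A group has EDT0L solution languages if it has a finite index normal subgroup `P` that is the
product of its quotients by a family of subgroups permuted by `G`, each of which extends to
a quotient with EDT0L solution languages of the corresponding stabilizer. -/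
theorem hasEDT0LEquations_of_action {G : Type} [Group G] (P : Subgroup G) [P.Normal]
    [P.FiniteIndex] {𝒳 : Type} [Finite 𝒳] [MulAction G 𝒳]
    (htriv : ∀ x ∈ P, ∀ i : 𝒳, x • i = i) (C : 𝒳 → Subgroup G)
    (hconj : ∀ (g : G) (i : 𝒳), ∀ x ∈ C i, g * x * g⁻¹ ∈ C (g • i))
    (hinter : ∀ x ∈ P, (∀ i, x ∈ C i) → x = 1)
    (hprod : ∀ f : 𝒳 → G, (∀ i, f i ∈ P) → ∃ x ∈ P, ∀ i, (f i)⁻¹ * x ∈ C i)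
    (W : 𝒳 → Type) [∀ i, Group (W i)] (π : ∀ i, stabilizer G i →* W i)
    (hπ : ∀ i, Function.Surjective (π i)) (hker : ∀ i x, π i x = 1 ↔ (x : G) ∈ C i)
    (hW : ∀ i, HasEDT0LEquations (W i)) : HasEDT0LEquations G := by
  let Ω := orbitRel.Quotient G 𝒳
  let r : Ω → 𝒳 := Quotient.out
  choose s hs using fun (ω : Ω) (i : orbit G (r ω)) => i.2
  have hs' : ∀ ω i, s ω i • r ω = (i : 𝒳) := hs
  have hstab : ∀ (ω : Ω) (i : orbit G (r ω)) (g : G),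
      (s ω (g • i))⁻¹ * g * s ω i ∈ stabilizer G (r ω) := by
    intro ω i g
    rw [mem_stabilizer_iff, mul_smul, mul_smul, hs', inv_smul_eq_iff, hs', orbit.coe_smul]
  let κ : ∀ ω : Ω, orbit G (r ω) → G → W (r ω) := fun ω i g => π (r ω) ⟨_, hstab ω i g⟩
  have hκ : ∀ ω i g h, κ ω i (g * h) = κ ω (h • i) g * κ ω i h := by
    intro ω i g h
    simp only [κ, ← map_mul]
    congr 1
    ext
    simp only [mul_smul, Subgroup.coe_mul]
    group
  have htriv' : ∀ ω : Ω, ∀ x ∈ P, ∀ i : orbit G (r ω), x • i = i := fun ω x hx i =>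
    Subtype.ext (htriv x hx i)
  have hPstab : ∀ (i : 𝒳), ∀ x ∈ P, x ∈ stabilizer G i := fun i x hx => htriv x hx i
  have hPconj : ∀ (g : G), ∀ x ∈ P, g⁻¹ * x * g ∈ P := fun g x hx => by
    simpa using ‹P.Normal›.conj_mem x hx g⁻¹
  have hκP : ∀ (ω : Ω) (i : orbit G (r ω)) (x : G) (hx : x ∈ P),
      κ ω i x = π (r ω) ⟨_, hPstab _ _ (hPconj (s ω i) x hx)⟩ := by
    intro ω i x hx
    simp only [κ, htriv' ω x hx]
  let V : ∀ ω : Ω, Subgroup (W (r ω)) := fun ω =>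
    (P.subgroupOf (stabilizer G (r ω))).map (π (r ω))
  have hVn : ∀ ω, (V ω).Normal := fun ω => Subgroup.Normal.map inferInstance _ (hπ _)
  have hVf : ∀ ω, (V ω).FiniteIndex := fun ω =>
    ⟨ne_zero_of_dvd_ne_zero Subgroup.FiniteIndex.index_ne_zero
      (Subgroup.index_map_dvd (P.subgroupOf (stabilizer G (r ω))) (hπ (r ω)))⟩
  let Φ₀ : P →* ∀ p : (Σ ω : Ω, orbit G (r ω)), V p.1 :=
    { toFun := fun x p => ⟨κ p.1 p.2 x, by
        rw [hκP _ _ _ x.2]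
        exact Subgroup.mem_map_of_mem _ (hPconj _ _ x.2)⟩
      map_one' := by
        funext p
        exact Subtype.ext (cocycle_one (κ p.1) (hκ p.1) p.2)
      map_mul' := by
        intro x y
        funext p
        refine Subtype.ext ?_
        have := hκ p.1 p.2 x y
        rwa [htriv' p.1 y y.2] at this }
  have hbij : Function.Bijective Φ₀ := by
    constructor
    · refine (injective_iff_map_eq_one Φ₀).2 fun x hx => Subtype.ext (hinter x x.2 fun i => ?_)
      obtain ⟨⟨ω, i⟩, rfl⟩ := (bijective_sigma_orbit_coe G 𝒳).2 i
      have h1 : κ ω i x = 1 := congrArg Subtype.val (congrFun hx ⟨ω, i⟩)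
      rw [hκP ω i x x.2, hker] at h1
      have h2 := hconj (s ω i) _ _ h1
      rw [hs'] at h2
      simpa [mul_assoc] using h2
    · intro y
      choose z hz hzy using fun p => (y p).2
      let e := Equiv.ofBijective _ (bijective_sigma_orbit_coe G 𝒳)
      obtain ⟨x, hx, hxC⟩ := hprod
        (fun i => s (e.symm i).1 (e.symm i).2 * z (e.symm i) * (s (e.symm i).1 (e.symm i).2)⁻¹)
        fun i => ‹P.Normal›.conj_mem _ (hz _) _
      refine ⟨⟨x, hx⟩, funext fun p => Subtype.ext ?_⟩
      have h1 := hxC (e p)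
      rw [Equiv.symm_apply_apply] at h1
      have h2 := hconj (s p.1 p.2)⁻¹ _ _ h1
      have h3 : (s p.1 p.2)⁻¹ • (e p : 𝒳) = r p.1 := by
        rw [inv_smul_eq_iff, hs']
        rfl
      rw [h3] at h2
      have h4 : κ p.1 p.2 x = (y p : W (r p.1)) := by
        rw [hκP _ _ x hx, ← hzy p, eq_comm, ← inv_mul_eq_one, ← map_inv, ← map_mul, hker]
        simpa [mul_assoc] using h2
      exact h4
  exact hasEDT0LEquations_of_cocycle P (fun ω : Ω => orbit G (r ω)) (fun ω => W (r ω)) V κ hκ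
    htriv' (MulEquiv.ofBijective Φ₀ hbij) (fun x p => rfl) fun ω => hW _

end Action

section Independent

variable {G 𝒳 : Type} [Group G] [Fintype 𝒳] [DecidableEq 𝒳] (H : 𝒳 → Subgroup G)
  (hcomm : Pairwise fun A B => ∀ x y : G, x ∈ H A → y ∈ H B → Commute x y)

theorem noncommPiCoprod_mem_of_apply_eq_one (A : 𝒳) (f : ∀ A, H A) (hf : f A = 1) :
    Subgroup.noncommPiCoprod hcomm f ∈ ⨆ (B) (_ : B ≠ A), H B := by
  rw [Subgroup.noncommPiCoprod_apply]
  refine Subgroup.noncommProd_mem _ _ fun B _ => ?_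
  by_cases hB : B = A
  · subst hB
    simp [hf]
  · exact (le_iSup₂ (f := fun B (_ : B ≠ A) => H B) B hB) (f B).2

theorem iSup_ne_le_map_noncommPiCoprod (A : 𝒳) :
    ⨆ (B) (_ : B ≠ A), H B ≤
      (Pi.evalMonoidHom (fun A => H A) A).ker.map (Subgroup.noncommPiCoprod hcomm) := by
  refine iSup₂_le fun B hB x hx => ⟨Pi.mulSingle B ⟨x, hx⟩, ?_, ?_⟩
  · simp [MonoidHom.mem_ker, Pi.mulSingle_eq_of_ne hB.symm]
  · simp

include hcomm in
/-- A group has EDT0L solution languages if it has a finite index normal subgroup that is an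
internal direct product of subgroups `H A` permuted by conjugation, where each `H A` lies in
a subgroup `K A` of the stabilizer of `A` disjoint from the other factors, such that all finite
index overgroups of `K A` have EDT0L solution languages. -/
theorem hasEDT0LEquations_of_disjoint [MulAction G 𝒳] (P : Subgroup G) [P.Normal]
    [P.FiniteIndex] (hP : P = ⨆ A, H A) (K : 𝒳 → Subgroup G)
    (htriv : ∀ x ∈ P, ∀ A : 𝒳, x • A = A)
    (hconj : ∀ (g : G) (A : 𝒳), ∀ x ∈ H A, g * x * g⁻¹ ∈ H (g • A))
    (hHK : ∀ A, H A ≤ K A) (hstab : ∀ A, K A ≤ MulAction.stabilizer G A)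
    (hdisj : ∀ A, Disjoint (K A) (⨆ (B) (_ : B ≠ A), H B))
    (hK : ∀ A, ∀ (W : Type) [Group W], ∀ (V : Subgroup W), V.FiniteIndex →
      Nonempty (K A ≃* V) → HasEDT0LEquations W) : HasEDT0LEquations G := by
  let ψ := Subgroup.noncommPiCoprod hcomm
  let C : 𝒳 → Subgroup G := fun A => ⨆ (B) (_ : B ≠ A), H B
  have hψC : ∀ (A : 𝒳) (f : ∀ A, H A), f A = 1 → ψ f ∈ C A :=
    noncommPiCoprod_mem_of_apply_eq_one H hcomm
  have hψP : ∀ x, x ∈ P ↔ ∃ f, ψ f = x := by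
    intro x
    rw [hP, ← Subgroup.noncommPiCoprod_range (hcomm := hcomm), MonoidHom.mem_range]
  have hCconj : ∀ (g : G) (A : 𝒳), ∀ x ∈ C A, g * x * g⁻¹ ∈ C (g • A) := by
    intro g A
    have : C A ≤ (C (g • A)).comap (MulAut.conj g).toMonoidHom := by
      refine iSup₂_le fun B hB x hx => ?_
      exact (le_iSup₂ (f := fun B (_ : B ≠ g • A) => H B) (g • B)
        (fun h => hB (smul_left_cancel g h))) (hconj g B x hx)
    exact fun x hx => this hx
  have hsplit : ∀ (A : 𝒳) (f : ∀ A, H A), ((f A : G))⁻¹ * ψ f ∈ C A := by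
    intro A f
    have := hψC A ((Pi.mulSingle A (f A))⁻¹ * f) (by simp)
    simpa [ψ] using this
  have hnormal : ∀ A, ((C A).subgroupOf (MulAction.stabilizer G A)).Normal := by
    refine fun A => ⟨fun x hx g => ?_⟩
    have := hCconj g A x hx
    rwa [g.2] at this
  refine hasEDT0LEquations_of_action P htriv C hCconj ?_ ?_
    (fun A => MulAction.stabilizer G A ⧸ (C A).subgroupOf (MulAction.stabilizer G A))
    (fun A => QuotientGroup.mk' _) (fun A => QuotientGroup.mk'_surjective _)
    (fun A x => QuotientGroup.eq_one_iff x) fun A => ?_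
  · intro x hx h
    obtain ⟨f, rfl⟩ := (hψP x).1 hx
    suffices f = 1 by rw [this, map_one]
    funext A
    have h1 : (f A : G) ∈ C A := by
      have := (C A).mul_mem (h A) ((C A).inv_mem (hsplit A f))
      simpa using this
    exact Subtype.ext ((Subgroup.disjoint_def.1 (hdisj A)) (hHK A (f A).2) h1)
  · intro f hf
    choose φ hφ using fun A => (hψP _).1 (hf A)
    refine ⟨ψ fun A => φ A A, (hψP _).2 ⟨_, rfl⟩, fun A => ?_⟩
    rw [← hφ, ← map_inv, ← map_mul]
    exact hψC A _ (by simp)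
  · let θ : K A →* MulAction.stabilizer G A ⧸ (C A).subgroupOf (MulAction.stabilizer G A) :=
      (QuotientGroup.mk' _).comp (Subgroup.inclusion (hstab A))
    have hθ : Function.Injective θ := by
      refine (injective_iff_map_eq_one θ).2 fun x hx => ?_
      have h1 : (x : G) ∈ C A := (QuotientGroup.eq_one_iff (Subgroup.inclusion (hstab A) x)).1 hx
      exact Subtype.ext ((Subgroup.disjoint_def.1 (hdisj A)) x.2 h1)
    refine hK A _ θ.range ?_ ⟨MonoidHom.ofInjective hθ⟩
    have hfin : ((P.subgroupOf (MulAction.stabilizer G A)).map (QuotientGroup.mk'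
        ((C A).subgroupOf (MulAction.stabilizer G A)))).FiniteIndex :=
      ⟨ne_zero_of_dvd_ne_zero Subgroup.FiniteIndex.index_ne_zero
        (Subgroup.index_map_dvd (P.subgroupOf (MulAction.stabilizer G A))
          (QuotientGroup.mk'_surjective _))⟩
    refine Subgroup.finiteIndex_of_le (H := (P.subgroupOf (MulAction.stabilizer G A)).map
      (QuotientGroup.mk' ((C A).subgroupOf (MulAction.stabilizer G A)))) ?_
    rintro _ ⟨x, hx, rfl⟩
    obtain ⟨f, hf⟩ := (hψP x).1 hx
    refine ⟨⟨f A, hHK A (f A).2⟩,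
      (QuotientGroup.eq (s := (C A).subgroupOf (MulAction.stabilizer G A))).2 ?_⟩
    have := hsplit A f
    rw [hf] at this
    exact this

end Independent

section Concrete

variable {G : Type} [Group G] {n : ℕ} (K : Fin n → Subgroup G)

theorem prod_ofFn_mulSingle (i : Fin n) (x : K i) :
    (List.ofFn fun j => ((Pi.mulSingle i x : ∀ j, K j) j : G)).prod = x := by
  rw [List.ofFn_eq_map, List.prod_map_eq_pow_single i]
  · rw [List.count_eq_one_of_mem (List.nodup_finRange n) (List.mem_finRange i)]
    simp
  · intro j hj _
    simp [Pi.mulSingle_eq_of_ne hj]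

theorem noncommPiCoprod_eq_prod_ofFn
    (hcomm : Pairwise fun i j => ∀ x y : G, x ∈ K i → y ∈ K j → Commute x y) (f : ∀ i, K i) :
    Subgroup.noncommPiCoprod hcomm f = (List.ofFn fun i => (f i : G)).prod := by
  rw [Subgroup.noncommPiCoprod_apply, List.ofFn_eq_map]
  have h := Finset.noncommProd_toFinset (List.finRange n) (fun i => (f i : G))
    (fun i _ j _ hij => hcomm hij _ _ (f i).2 (f j).2) (List.nodup_finRange n)
  rw [← h]
  congr 1
  simp

variable (hinj : Function.Injective
  (fun f : (i : Fin n) → ↥(K i) => (List.ofFn fun i => ((f i : G))).prod))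

include hinj

theorem disjoint_of_injective_prod {i j : Fin n} (hij : i ≠ j) : Disjoint (K i) (K j) := by
  refine Subgroup.disjoint_def.2 fun {x} hi hj => ?_
  have h := @hinj (Pi.mulSingle i ⟨x, hi⟩) (Pi.mulSingle j ⟨x, hj⟩)
    ((prod_ofFn_mulSingle K i ⟨x, hi⟩).trans (prod_ofFn_mulSingle K j ⟨x, hj⟩).symm)
  have h1 := congrFun h i
  rw [Pi.mulSingle_eq_same, Pi.mulSingle_eq_of_ne hij] at h1
  exact congrArg Subtype.val h1

/-- A factor is disjoint from the join of commuting subgroups of the other factors. -/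
theorem disjoint_iSup_of_injective_prod (H : Fin n → Subgroup G) (hH : ∀ i, H i ≤ K i)
    (hcomm : Pairwise fun i j => ∀ x y : G, x ∈ H i → y ∈ H j → Commute x y) (i : Fin n) :
    Disjoint (K i) (⨆ (j) (_ : j ≠ i), H j) := by
  refine Subgroup.disjoint_def.2 fun {x} hi hj => ?_
  obtain ⟨f, hf, rfl⟩ := iSup_ne_le_map_noncommPiCoprod H hcomm i hj
  rw [noncommPiCoprod_eq_prod_ofFn] at hi ⊢
  have h := @hinj (fun j => ⟨f j, hH j (f j).2⟩) (Pi.mulSingle i ⟨_, hi⟩)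
    (prod_ofFn_mulSingle K i ⟨_, hi⟩).symm
  have h1 := congrArg Subtype.val (congrFun h i)
  rw [Pi.mulSingle_eq_same] at h1
  exact h1.symm.trans (congrArg Subtype.val hf)

omit hinj in
/-- A normal subgroup containing finite index subgroups of the factors has finite index. -/
theorem finiteIndex_of_prod (N : Subgroup G) [N.FiniteIndex]
    (hN : (N : Set G) ⊆
      Set.range (fun f : (i : Fin n) → ↥(K i) => (List.ofFn fun i => ((f i : G))).prod))
    (P : Subgroup G) [P.Normal] (hP : ∀ i, (P.subgroupOf (K i)).FiniteIndex) :
    P.FiniteIndex := by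
  let q := QuotientGroup.mk' P
  have hfin : ∀ i, Finite ((K i).map q) := by
    intro i
    have h1 : (q.comp (K i).subtype).ker = P.subgroupOf (K i) := by
      ext x
      simp [q, MonoidHom.mem_ker, Subgroup.mem_subgroupOf]
    have h2 := Subgroup.index_ker (q.comp (K i).subtype)
    rw [h1, MonoidHom.range_comp, Subgroup.range_subtype] at h2
    exact Nat.finite_of_card_ne_zero (h2 ▸ (hP i).index_ne_zero)
  have hNfin : Finite (N.map q) := by
    have hr : (Set.range fun f : (i : Fin n) → (K i).map q =>
      (List.ofFn fun i => ((f i : G ⧸ P))).prod).Finite := Set.finite_range _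
    refine (hr.subset ?_).to_subtype
    rintro _ ⟨x, hx, rfl⟩
    obtain ⟨f, rfl⟩ := hN hx
    refine ⟨fun i => ⟨q (f i), Subgroup.mem_map_of_mem _ (f i).2⟩, ?_⟩
    simp [map_list_prod, List.map_ofFn, Function.comp_def]
  have hindex : (N.map q).index ≠ 0 :=
    ne_zero_of_dvd_ne_zero (Subgroup.FiniteIndex.index_ne_zero (H := N))
      (Subgroup.index_map_dvd N (QuotientGroup.mk'_surjective P))
  refine ⟨?_⟩
  rw [Subgroup.index, ← Subgroup.card_mul_index (N.map q)]
  exact mul_ne_zero Nat.card_pos.ne' hindex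

end Concrete

/-- Let `G` contain `K₁ × ⋯ × Kₙ` as a finite index normal subgroup
`N` (each `Kᵢ` a subgroup of `G`, the multiplication map `(∏ᵢ Kᵢ) → G` injective with
image `N`), such that every conjugate of each `Kᵢ` is some `Kⱼ`. If for each `i` every
group containing an isomorphic copy of `Kᵢ` as a finite index subgroup admits a finite
generating set and normal form with EDT0L solution languages for all finite systems of
equations, then `G` admits a finite generating set and a normal form with respect to
which the solution language of every finite system of equations in `G` is EDT0L. -/
theorem edt0l_virtual_direct_product {G : Type} [Group G]
    (n : ℕ) (K : Fin n → Subgroup G)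
    (N : Subgroup G) [N.Normal] [N.FiniteIndex]
    (hprod : (N : Set G) =
      Set.range (fun f : (i : Fin n) → ↥(K i) => (List.ofFn fun i => ((f i : G))).prod))
    (hinj : Function.Injective
      (fun f : (i : Fin n) → ↥(K i) => (List.ofFn fun i => ((f i : G))).prod))
    (hconj : ∀ (g : G) (i : Fin n), ∃ j : Fin n,
      Subgroup.map (MulAut.conj g).toMonoidHom (K i) = K j)
    (hK : ∀ i : Fin n, ∀ (W : Type) [Group W], ∀ (V : Subgroup W), V.FiniteIndex →
      Nonempty (↥(K i) ≃* ↥V) →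
      ∃ (ι : Type) (_ : Fintype ι) (gen : ι → W) (η : W → List (ι × Bool)),
        Subgroup.closure (Set.range gen) = ⊤ ∧ (∀ w, evalWord gen (η w) = w) ∧
        ∀ (m : ℕ) (E : Set (Monoid.Coprod W (FreeGroup (Fin m)))), E.Finite →
          IsEDT0L (solutionLanguage η E)) :
    ∃ (ι : Type) (_ : Fintype ι) (gen : ι → G) (η : G → List (ι × Bool)),
      Subgroup.closure (Set.range gen) = ⊤ ∧ (∀ g, evalWord gen (η g) = g) ∧
      ∀ (m : ℕ) (E : Set (Monoid.Coprod G (FreeGroup (Fin m)))), E.Finite →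
        IsEDT0L (solutionLanguage η E) := by
  classical
  let 𝒳 := Set.range K
  have hfix : ∀ (A : Subgroup G), ∀ x ∈ A, A.map (MulAut.conj x).toMonoidHom = A := by
    intro A x hx
    ext y
    constructor
    · rintro ⟨z, hz, rfl⟩
      exact A.mul_mem (A.mul_mem hx hz) (A.inv_mem hx)
    · intro hy
      exact ⟨x⁻¹ * y * x, A.mul_mem (A.mul_mem (A.inv_mem hx) hy) hx, by simp [mul_assoc]⟩
  let act : MulAction G 𝒳 :=
    { smul := fun g A => ⟨A.1.map (MulAut.conj g).toMonoidHom, by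
        obtain ⟨i, hi⟩ := A.2
        obtain ⟨j, hj⟩ := hconj g i
        exact ⟨j, by rw [← hi, hj]⟩⟩
      one_smul := fun A => Subtype.ext (hfix A.1 1 A.1.one_mem)
      mul_smul := fun g h A => Subtype.ext <| by
        change A.1.map _ = (A.1.map _).map _
        rw [Subgroup.map_map, map_mul]
        rfl }
  have hact : ∀ (g : G) (A : 𝒳), ∀ x ∈ A.1, g * x * g⁻¹ ∈ (g • A).1 := fun g A x hx =>
    ⟨x, hx, rfl⟩
  let D := (MulAction.toPermHom G 𝒳).ker
  have hD : ∀ x ∈ D, ∀ A : 𝒳, x • A = A := fun x hx A =>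
    congrFun (congrArg DFunLike.coe (MonoidHom.mem_ker.1 hx)) A
  have : D.FiniteIndex := inferInstance
  choose σ hσ using fun A : 𝒳 => A.2
  have hσinj : Function.Injective σ := fun A B h => Subtype.ext (by rw [← hσ A, ← hσ B, h])
  have hcommX : Pairwise fun A B : 𝒳 => ∀ x y : G, x ∈ A.1 ⊓ D → y ∈ B.1 ⊓ D → Commute x y := by
    intro A B hAB x y hx hy
    have hdisj : Disjoint A.1 B.1 := by
      rw [← hσ A, ← hσ B]
      exact disjoint_of_injective_prod K hinj (hσinj.ne hAB)
    have h1 := hact y A x⁻¹ (A.1.inv_mem hx.1)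
    have h2 := hact x B y hy.1
    rw [hD y hy.2] at h1
    rw [hD x hx.2] at h2
    have h3 : x * y * x⁻¹ * y⁻¹ = 1 := by
      refine Subgroup.disjoint_def.1 hdisj ?_ (B.1.mul_mem h2 (B.1.inv_mem hy.1))
      have := A.1.mul_mem hx.1 h1
      simpa only [mul_assoc] using this
    exact mul_inv_eq_iff_eq_mul.1 (mul_inv_eq_one.1 h3)
  have hcomm : Pairwise fun i j => ∀ x y : G, x ∈ K i ⊓ D → y ∈ K j ⊓ D → Commute x y := by
    intro i j hij x y hx hy
    by_cases hKij : K i = K j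
    · have h1 := disjoint_of_injective_prod K hinj hij
      rw [hKij, disjoint_self] at h1
      have h2 : y ∈ K j := hy.1
      rw [h1, Subgroup.mem_bot] at h2
      rw [h2]
      exact Commute.one_right x
    · exact hcommX (i := ⟨K i, i, rfl⟩) (j := ⟨K j, j, rfl⟩)
        (fun h => hKij (congrArg Subtype.val h)) x y hx hy
  let H : 𝒳 → Subgroup G := fun A => A.1 ⊓ D
  have hHconj : ∀ (g : G) (A : 𝒳), ∀ x ∈ H A, g * x * g⁻¹ ∈ H (g • A) := fun g A x hx =>
    ⟨hact g A x hx.1, (inferInstance : D.Normal).conj_mem x hx.2 g⟩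
  let P : Subgroup G := ⨆ A, H A
  have hPn : P.Normal := by
    refine ⟨fun x hx g => ?_⟩
    have : P ≤ P.comap (MulAut.conj g).toMonoidHom :=
      iSup_le fun A y hy => le_iSup H (g • A) (hHconj g A y hy)
    exact this hx
  have hPf : P.FiniteIndex := by
    refine finiteIndex_of_prod K N hprod.subset P fun i => ?_
    have h1 : (D.subgroupOf (K i)).FiniteIndex := inferInstance
    exact Subgroup.finiteIndex_of_le (H := D.subgroupOf (K i)) fun x hx =>
      le_iSup H ⟨K i, i, rfl⟩ ⟨x.2, hx⟩
  have hPD : P ≤ D := iSup_le fun A => inf_le_right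
  refine hasEDT0LEquations_of_disjoint H hcommX P rfl (fun A => A.1) (fun x hx => hD x (hPD hx))
    hHconj (fun A => inf_le_left) (fun A x hx => Subtype.ext (hfix A.1 x hx)) (fun A => ?_)
    fun A W _ V hV hVW => ?_
  · have h1 := disjoint_iSup_of_injective_prod K hinj (fun i => K i ⊓ D) (fun i => inf_le_left)
      hcomm (σ A)
    rw [hσ A] at h1
    refine h1.mono_right (iSup₂_le fun B hB => ?_)
    have h2 := le_iSup₂ (f := fun j (_ : j ≠ σ A) => K j ⊓ D) (σ B) (hσinj.ne hB)
    rwa [hσ B] at h2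
  · rw [← hσ A] at hVW
    exact hK (σ A) W V hV hVW

end Paper
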